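/- Let A, B be finite algebras in a locally finite Taylor variety, and let ρ ∈ Con(A), σ ∈ Con(B) be meet-irreducible with unique upper covers ρ⁺, σ⁺ respectively, such that ρ⁺/ρ and σ⁺/σ are abelian. Then for every bridge T from (A,ρ,ρ⁺) to (B,σ,σ⁺), the bridge T' := T^opt_{(A,ρ)} ∘ T ∘ T^opt_{(B,σ)} contains a bridge T₁ from (A,ρ,ρ⁺) to (B,σ,σ⁺) with tr(T₁) = tr(T') and satisfying property (B3): for all (a₁,a₂,b₁,b₂) ∈ T₁, both (a₁,b₁) ∈ tr(T₁) and (a₂,b₂) ∈ tr(T₁). -/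

import Mathlib

namespace Zhuk

/-- A signature: a type of operation symbols with arities. -/
structure Signature where
  ops : Type
  arity : ops → ℕ

/-- An algebra structure of signature `S` on carrier `A`. -/
class SAlg (S : Signature) (A : Type) where
  interp : (o : S.ops) → (Fin (S.arity o) → A) → A

variable {S : Signature}

/-- Componentwise algebra structure on a product. -/
instance prodSAlg {A B : Type} [SAlg S A] [SAlg S B] : SAlg S (A × B) :=
  ⟨fun o x => (SAlg.interp o fun i => (x i).1, SAlg.interp o fun i => (x i).2)⟩

/-- A subset closed under all the operations. -/
def IsSubuniverse (S : Signature) {A : Type} [SAlg S A] (R : Set A) : Prop :=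
  ∀ (o : S.ops) (x : Fin (S.arity o) → A), (∀ i, x i ∈ R) → SAlg.interp o x ∈ R

/-- The algebra structure on (the subtype of) a subuniverse. -/
def subAlg {A : Type} [SAlg S A] (R : Set A) (h : IsSubuniverse S R) : SAlg S ↥R :=
  ⟨fun o x => ⟨SAlg.interp o fun i => (x i).1, h o _ fun i => (x i).2⟩⟩

/-- Terms of signature `S` in `n` variables. -/
inductive STerm (S : Signature) (n : ℕ) : Type
  | var : Fin n → STerm S n
  | app (o : S.ops) : (Fin (S.arity o) → STerm S n) → STerm S n

/-- Evaluation of a term in an algebra. -/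
def STerm.eval {A : Type} [SAlg S A] {n : ℕ} : STerm S n → (Fin n → A) → A
  | .var i, v => v i
  | .app o ts, v => SAlg.interp o fun i => (ts i).eval v

/-- The diagonal (smallest) congruence `0_A`. -/
def diag (A : Type) : Set (A × A) := {p | p.1 = p.2}

/-- Relational composition. -/
def rcomp {A B C : Type} (R : Set (A × B)) (T : Set (B × C)) : Set (A × C) :=
  {p | ∃ b, (p.1, b) ∈ R ∧ (b, p.2) ∈ T}

/-- Relational inverse. -/
def rinv {A B : Type} (R : Set (A × B)) : Set (B × A) := {p | (p.2, p.1) ∈ R}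

/-- Transitive closure of a binary relation (as a set of pairs). -/
def transCl {A : Type} (R : Set (A × A)) : Set (A × A) :=
  {p | Relation.TransGen (fun a b => (a, b) ∈ R) p.1 p.2}

/-- `R` is stable under (saturated with respect to) `ρ`:  `R = ρ ∘ R ∘ ρ`. -/
def Saturated {A : Type} (ρ R : Set (A × A)) : Prop := rcomp ρ (rcomp R ρ) = R

/-- A congruence: a subuniverse of `A²` which is an equivalence relation. -/
def IsCongruence (S : Signature) {A : Type} [SAlg S A] (θ : Set (A × A)) : Prop :=
  IsSubuniverse S θ ∧ Equivalence fun a b => (a, b) ∈ θ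

/-- `ρ ∈ Con*(A)`: a congruence different from the full congruence `1_A`. -/
def ConStar (S : Signature) {A : Type} [SAlg S A] (ρ : Set (A × A)) : Prop :=
  IsCongruence S ρ ∧ ρ ≠ Set.univ

/-- The ternary centralizer relation `C(φ, θ; δ)`, via the term condition. -/
def Centralizes (S : Signature) {A : Type} [SAlg S A] (φ θ δ : Set (A × A)) : Prop :=
  ∀ (n : ℕ) (t : STerm S (n + 1)) (a b : A) (c d : Fin n → A),
    (a, b) ∈ φ → (∀ i, (c i, d i) ∈ θ) →
    (t.eval (Fin.cons a c), t.eval (Fin.cons a d)) ∈ δ →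
    (t.eval (Fin.cons b c), t.eval (Fin.cons b d)) ∈ δ

/-- The centralizer `(δ : θ)`: the largest congruence `φ` with `C(φ, θ; δ)`. -/
def centralizer (S : Signature) {A : Type} [SAlg S A] (δ θ : Set (A × A)) : Set (A × A) :=
  ⋃₀ {φ | IsCongruence S φ ∧ Centralizes S φ θ δ}

/-- A congruence of the subalgebra `A(θ) ≤ A²`, viewed ambiently as a subset of
`(A×A) × (A×A)` whose field is `θ`. -/
def IsConOn (S : Signature) {A : Type} [SAlg S A] (θ : Set (A × A))
    (Δ : Set ((A × A) × (A × A))) : Prop :=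
  Δ ⊆ θ ×ˢ θ ∧ IsSubuniverse S Δ ∧ (∀ p ∈ θ, (p, p) ∈ Δ) ∧
    (∀ p q, (p, q) ∈ Δ → (q, p) ∈ Δ) ∧ (∀ p q r, (p, q) ∈ Δ → (q, r) ∈ Δ → (p, r) ∈ Δ)

/-- `Δ_{θ,α}`: the congruence of `A(θ)` generated by `{((a,a),(b,b)) : (a,b) ∈ α}`. -/
def DeltaCon (S : Signature) {A : Type} [SAlg S A] (θ α : Set (A × A)) :
    Set ((A × A) × (A × A)) :=
  ⋂₀ {Δ | IsConOn S θ Δ ∧ ∀ a b : A, (a, b) ∈ α → ((a, a), (b, b)) ∈ Δ}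

/-- Projection of a quaternary relation to its first two coordinates. -/
def pr12 {A B : Type} (T : Set (A × A × B × B)) : Set (A × A) :=
  {p | ∃ b₁ b₂, (p.1, p.2, b₁, b₂) ∈ T}

/-- Projection of a quaternary relation to its last two coordinates. -/
def pr34 {A B : Type} (T : Set (A × A × B × B)) : Set (B × B) :=
  {q | ∃ a₁ a₂, (a₁, a₂, q.1, q.2) ∈ T}

/-- The trace of a quaternary relation. -/
def btr {A B : Type} (T : Set (A × A × B × B)) : Set (A × B) :=
  {p | (p.1, p.1, p.2, p.2) ∈ T}

/-- Zhuk's bridges: Definition 4.3 (B0*), (B1*), (B2*). -/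
def IsBridge (S : Signature) {A B : Type} [SAlg S A] [SAlg S B]
    (ρ : Set (A × A)) (σ : Set (B × B)) (T : Set (A × A × B × B)) : Prop :=
  IsSubuniverse S T ∧
  (∀ a₁ a₂ b₁ b₂ a₁' a₂', (a₁, a₂, b₁, b₂) ∈ T → (a₁, a₁') ∈ ρ → (a₂, a₂') ∈ ρ →
    (a₁', a₂', b₁, b₂) ∈ T) ∧
  (∀ a₁ a₂ b₁ b₂ b₁' b₂', (a₁, a₂, b₁, b₂) ∈ T → (b₁, b₁') ∈ σ → (b₂, b₂') ∈ σ →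
    (a₁, a₂, b₁', b₂') ∈ T) ∧
  ρ ⊂ pr12 T ∧ σ ⊂ pr34 T ∧
  (∀ a₁ a₂ b₁ b₂, (a₁, a₂, b₁, b₂) ∈ T → ((a₁, a₂) ∈ ρ ↔ (b₁, b₂) ∈ σ))

/-- A bridge from `(A,ρ,L)` to `(B,σ,R)`: a bridge with prescribed anchors. -/
def IsBridgeLR (S : Signature) {A B : Type} [SAlg S A] [SAlg S B]
    (ρ : Set (A × A)) (σ : Set (B × B)) (L : Set (A × A)) (R : Set (B × B))
    (T : Set (A × A × B × B)) : Prop :=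
  IsBridge S ρ σ T ∧ pr12 T = L ∧ pr34 T = R

/-- A reflexive bridge (case `B = A`): `0_A ⊆ tr(T)`. -/
def ReflBridge {A : Type} (T : Set (A × A × A × A)) : Prop :=
  ∀ a : A, (a, a) ∈ btr T

/-- `Cov(ρ)`: the inclusion-minimal ρ-saturated subuniverses of `A²` properly containing ρ. -/
def Cov (S : Signature) {A : Type} [SAlg S A] (ρ : Set (A × A)) : Set (Set (A × A)) :=
  {L | IsSubuniverse S L ∧ Saturated ρ L ∧ ρ ⊂ L ∧
    ∀ L', IsSubuniverse S L' → Saturated ρ L' → ρ ⊂ L' → L' ⊆ L → L' = L}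

/-- `ref.tr(ρ,L)`: traces of reflexive bridges from `(A,ρ,L)` to itself. -/
def refTr (S : Signature) {A : Type} [SAlg S A] (ρ L : Set (A × A)) : Set (Set (A × A)) :=
  {γ | ∃ T : Set (A × A × A × A), IsBridgeLR S ρ ρ L L T ∧ ReflBridge T ∧ btr T = γ}

/-- `γ = Opt(ρ,L)`: `γ` is the (unique) inclusion-maximal member of `ref.tr(ρ,L)`. -/
def IsOptOf (S : Signature) {A : Type} [SAlg S A] (ρ L γ : Set (A × A)) : Prop :=
  γ ∈ refTr S ρ L ∧ ∀ δ ∈ refTr S ρ L, γ ⊆ δ → δ = γ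

/-- `ρ` is meet-irreducible with unique upper cover `ρplus`. -/
def MeetIrredWith (S : Signature) {A : Type} [SAlg S A] (ρ ρplus : Set (A × A)) : Prop :=
  IsCongruence S ρ ∧ ρ ≠ Set.univ ∧ IsCongruence S ρplus ∧ ρ ⊂ ρplus ∧
    ∀ θ, IsCongruence S θ → ρ ⊂ θ → ρplus ⊆ θ

/-- `Cov⁺(ρ) = {τ ∈ Cov(ρ) : τ ⊆ ρ⁺}`. -/
def CovPlus (S : Signature) {A : Type} [SAlg S A] (ρ ρplus : Set (A × A)) :
    Set (Set (A × A)) :=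
  {τ | τ ∈ Cov S ρ ∧ τ ⊆ ρplus}

/-- A good bridge between meet-irreducible congruences with upper covers `ρplus`, `σplus`. -/
def GoodBridge (S : Signature) {A B : Type} [SAlg S A] [SAlg S B]
    (ρ ρplus : Set (A × A)) (σ σplus : Set (B × B)) (T : Set (A × A × B × B)) : Prop :=
  IsBridge S ρ σ T ∧
    ∃ τ ∈ CovPlus S ρ ρplus, ∃ τ' ∈ CovPlus S σ σplus, ∃ T' ⊆ T,
      IsBridgeLR S ρ σ τ τ' T' ∧ btr T' = btr T

/-- `t` (with Taylor-identity data `u v`) is idempotent on `A` and satisfies the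
corresponding identities on `A`. -/
def TaylorOn (S : Signature) (A : Type) [SAlg S A] {n : ℕ} (t : STerm S n)
    (u v : Fin n → Fin n → Fin 2) : Prop :=
  (∀ a : A, t.eval (fun _ => a) = a) ∧
    ∀ (i : Fin n) (x y : A),
      t.eval (fun j => if u i j = 0 then x else y) =
        t.eval (fun j => if v i j = 0 then x else y)

/-- `A` is a Taylor algebra. -/
def IsTaylorAlg (S : Signature) (A : Type) [SAlg S A] : Prop :=
  ∃ (n : ℕ) (t : STerm S n) (u v : Fin n → Fin n → Fin 2),
    1 < n ∧ (∀ i, u i i ≠ v i i) ∧ TaylorOn S A t u v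

/-- `A` and `B` lie in a common (locally finite, as they are finite) Taylor variety:
they share a common Taylor term with common Taylor identities. -/
def CommonTaylor (S : Signature) (A B : Type) [SAlg S A] [SAlg S B] : Prop :=
  ∃ (n : ℕ) (t : STerm S n) (u v : Fin n → Fin n → Fin 2),
    1 < n ∧ (∀ i, u i i ≠ v i i) ∧ TaylorOn S A t u v ∧ TaylorOn S B t u v

/-- The quotient of `A` by (the equivalence relation of) `θ`. -/
abbrev ConQuot {A : Type} (θ : Set (A × A)) : Type :=
  Quot (fun a b => (a, b) ∈ θ)

/-- The class of `a` in `A/θ`. -/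
def ConQuot.mk {A : Type} (θ : Set (A × A)) (a : A) : ConQuot θ :=
  Quot.mk _ a

/-- The quotient algebra structure on `A/θ` (extensionally correct when `θ` is a
congruence). -/
noncomputable def quotAlg {S : Signature} {A : Type} (iA : SAlg S A) (θ : Set (A × A)) :
    SAlg S (ConQuot θ) :=
  ⟨fun o x => ConQuot.mk θ
    (@SAlg.interp S A iA o fun i => Classical.choose (Quot.exists_rep (x i)))⟩

/-- `f` is a homomorphism with respect to the given algebra structures. -/
def IsHomI {S : Signature} {A B : Type} (iA : SAlg S A) (iB : SAlg S B) (f : A → B) : Prop :=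
  ∀ (o : S.ops) (x : Fin (S.arity o) → A),
    f (@SAlg.interp S A iA o x) = @SAlg.interp S B iB o fun i => f (x i)

/-- The two algebras are isomorphic. -/
def IsoAlgI {S : Signature} {A B : Type} (iA : SAlg S A) (iB : SAlg S B) : Prop :=
  ∃ f : A ≃ B, IsHomI iA iB f

/-- The identity bridge `I_{(A,ρ,L)}`. -/
def idBridge {A : Type} (ρ L : Set (A × A)) : Set (A × A × A × A) :=
  {p | (p.1, p.2.1) ∈ L ∧ (p.2.2.1, p.2.2.2) ∈ L ∧ (p.1, p.2.2.1) ∈ ρ ∧ (p.2.1, p.2.2.2) ∈ ρ}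

/-- Composition of quaternary relations (bridges). -/
def bComp {A B C : Type} (T : Set (A × A × B × B)) (T' : Set (B × B × C × C)) :
    Set (A × A × C × C) :=
  {p | ∃ b₁ b₂, (p.1, p.2.1, b₁, b₂) ∈ T ∧ (b₁, b₂, p.2.2.1, p.2.2.2) ∈ T'}

/-- Converse of a quaternary relation (bridge). -/
def bConv {A B : Type} (T : Set (A × A × B × B)) : Set (B × B × A × A) :=
  {p | (p.2.2.1, p.2.2.2, p.1, p.2.1) ∈ T}

/-- `Δ♭_{θ,α}`: the congruence `Δ_{θ,α}` of `A(θ)` viewed as a quaternary relation. -/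
def deltaFlat (S : Signature) {A : Type} [SAlg S A] (θ α : Set (A × A)) :
    Set (A × A × A × A) :=
  {p | ((p.1, p.2.1), (p.2.2.1, p.2.2.2)) ∈ DeltaCon S θ α}

/-- `T^opt_{(A,ρ)} = I_{(A,ρ,ρ⁺)} ∘ Δ♭_{ρ⁺,(ρ:ρ⁺)} ∘ I_{(A,ρ,ρ⁺)}`. -/
def Topt (S : Signature) {A : Type} [SAlg S A] (ρ ρplus : Set (A × A)) :
    Set (A × A × A × A) :=
  bComp (idBridge ρ ρplus)
    (bComp (deltaFlat S ρplus (centralizer S ρ ρplus)) (idBridge ρ ρplus))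

/-- `A` is subdirectly irreducible with monolith `μ`. -/
def IsMonolith (S : Signature) {A : Type} [SAlg S A] (μ : Set (A × A)) : Prop :=
  IsCongruence S μ ∧ μ ≠ diag A ∧ ∀ θ, IsCongruence S θ → θ ≠ diag A → μ ⊆ θ

/-- The carrier of `D(A,θ)`-style quotients: `A(μ)/Δ_{μ,α}`. -/
abbrev DCar (S : Signature) (A : Type) [SAlg S A] (μ α : Set (A × A)) : Type :=
  Quot (fun p q : ↥μ => ((p : A × A), (q : A × A)) ∈ DeltaCon S μ α)

/-- The class of a pair `p ∈ μ` in `A(μ)/Δ_{μ,α}`. -/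
def DCar.mk (S : Signature) (A : Type) [SAlg S A] (μ α : Set (A × A)) (p : ↥μ) :
    DCar S A μ α :=
  Quot.mk _ p

/-- The algebra structure on `A(μ)/Δ_{μ,α}` (extensionally correct when `μ` is a
congruence and `Δ_{μ,α}` is a congruence of `A(μ)`). -/
noncomputable def DAlg (S : Signature) (A : Type) [SAlg S A] (μ α : Set (A × A))
    (h : IsSubuniverse S μ) : SAlg S (DCar S A μ α) :=
  letI := subAlg μ h
  ⟨fun o x => DCar.mk S A μ α
    (SAlg.interp o fun i => Classical.choose (Quot.exists_rep (x i)))⟩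

/-- The canonical similarity bridge `T_{D(A)}` from `A` to `D(A)`. -/
def TDBridge (S : Signature) (A : Type) [SAlg S A] (μ α : Set (A × A)) :
    Set (A × A × DCar S A μ α × DCar S A μ α) :=
  {x | ∃ (a b e : A) (_ : (a, b) ∈ μ) (h1 : (a, e) ∈ μ) (h2 : (b, e) ∈ μ),
    x = (a, b, DCar.mk S A μ α ⟨(a, e), h1⟩, DCar.mk S A μ α ⟨(b, e), h2⟩)}

/-- Similarity of (subdirectly irreducible) algebras: `D(A) ≅ D(B)`, where `D(X)` is
`X(μ)/Δ_{μ,(0:μ)}` if the monolith `μ` is abelian, and `X` itself otherwise. -/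
def SimilarI (S : Signature) {A B : Type} (iA : SAlg S A) (iB : SAlg S B) : Prop :=
  letI := iA
  letI := iB
  ∃ (μA : Set (A × A)) (μB : Set (B × B)) (hA : IsMonolith S μA) (hB : IsMonolith S μB),
    ((Centralizes S μA μA (diag A) ∧ Centralizes S μB μB (diag B)) →
      IsoAlgI (DAlg S A μA (centralizer S (diag A) μA) hA.1.1)
        (DAlg S B μB (centralizer S (diag B) μB) hB.1.1)) ∧
    ((Centralizes S μA μA (diag A) ∧ ¬ Centralizes S μB μB (diag B)) →
      IsoAlgI (DAlg S A μA (centralizer S (diag A) μA) hA.1.1) iB) ∧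
    ((¬ Centralizes S μA μA (diag A) ∧ Centralizes S μB μB (diag B)) →
      IsoAlgI iA (DAlg S B μB (centralizer S (diag B) μB) hB.1.1)) ∧
    ((¬ Centralizes S μA μA (diag A) ∧ ¬ Centralizes S μB μB (diag B)) →
      IsoAlgI iA iB)

end Zhuk

namespace Zhuk

theorem exists_iterate_idempotent {X : Type} [Finite X] (f : X → X) :
    ∃ k, ∀ x, f^[k + 1] (f^[k + 1] x) = f^[k + 1] x := by
  obtain ⟨a, b, hab, he⟩ := Finite.exists_ne_map_eq_of_infinite (fun m : ℕ => f^[m])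
  wlog hlt : a < b generalizing a b
  · exact this b a hab.symm he.symm (by omega)
  obtain ⟨p, rfl⟩ := Nat.exists_eq_add_of_lt hlt
  have step : ∀ j, a ≤ j → f^[j + (p + 1)] = f^[j] := by
    intro j hj
    obtain ⟨c, rfl⟩ := Nat.exists_eq_add_of_le hj
    rw [show a + c + (p + 1) = c + (a + p + 1) by ring, Function.iterate_add,
      ← show f^[a] = _ from he, ← Function.iterate_add, add_comm]
  have steps : ∀ c j, a ≤ j → f^[j + c * (p + 1)] = f^[j] := by
    intro c
    induction c with
    | zero => simp
    | succ c ih =>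
      intro j hj
      rw [show j + (c + 1) * (p + 1) = (j + c * (p + 1)) + (p + 1) by ring,
        step _ (by omega), ih j hj]
  refine ⟨(a + 1) * (p + 1) - 1, fun x => ?_⟩
  have h1 : (a + 1) * (p + 1) - 1 + 1 = (a + 1) * (p + 1) :=
    Nat.sub_add_cancel (Nat.mul_pos (by omega) (by omega))
  rw [h1, ← Function.iterate_add_apply, steps]
  nlinarith

/-- An operation preserving a reflexive relation preserves its transitive closure. -/
theorem reflTransGen_compatible {F : Type} {n : ℕ} (τ : (Fin n → F) → F) (R : F → F → Prop)
    (hrefl : ∀ x, R x x) (hR : ∀ a b : Fin n → F, (∀ i, R (a i) (b i)) → R (τ a) (τ b))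
    (a b : Fin n → F) (hab : ∀ i, Relation.ReflTransGen R (a i) (b i)) :
    Relation.ReflTransGen R (τ a) (τ b) := by
  classical
  have key : ∀ s : Finset (Fin n), Relation.ReflTransGen R (τ a) (τ (s.piecewise b a)) := by
    intro s
    induction s using Finset.induction_on with
    | empty => simpa using Relation.ReflTransGen.refl
    | insert i s his ih =>
      refine ih.trans ?_
      have h := Relation.ReflTransGen.lift (p := R)
        (fun z => τ (Function.update (s.piecewise b a) i z)) (fun x y hxy => hR _ _ fun j => by
          by_cases hj : j = i
          · subst hj; simpa using hxy
          · simpa [hj] using hrefl _) _ _ (hab i)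
      rw [Finset.piecewise_insert]
      simp only [Function.onFun] at h
      rwa [show Function.update (s.piecewise b a) i (a i) = s.piecewise b a by
        rw [Function.update_eq_iff]; simp [his]] at h
  simpa using key Finset.univ

/-- On a finite algebra with a Taylor operation, if the kernels of all iterates of the
translations by the operation are independent of the parameters, then every compatible
quasiorder is symmetric. -/
theorem compatible_quasiorder_symm {F : Type} [Finite F] {n : ℕ} (τ : (Fin n → F) → F)
    (idem : ∀ a, τ (fun _ => a) = a)
    (u v : Fin n → Fin n → Fin 2) (huv : ∀ i, u i i ≠ v i i)
    (taylor : ∀ i x y, τ (fun j => if u i j = 0 then x else y) =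
      τ (fun j => if v i j = 0 then x else y))
    (tc : ∀ (i : Fin n) (k : ℕ) (y y' : Fin n → F) (x x' : F),
      (fun z => τ (Function.update y i z))^[k] x = (fun z => τ (Function.update y i z))^[k] x' →
      (fun z => τ (Function.update y' i z))^[k] x =
        (fun z => τ (Function.update y' i z))^[k] x')
    (Q : F → F → Prop) (hrefl : ∀ x, Q x x) (htrans : ∀ x y z, Q x y → Q y z → Q x z)
    (hQ : ∀ a b : Fin n → F, (∀ i, Q (a i) (b i)) → Q (τ a) (τ b))
    (a b : F) (hab : Q a b) : Q b a := by
  classical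
  by_contra hba
  have := Fintype.ofFinite F
  -- a strictly increasing pair with minimal interval
  obtain ⟨⟨a, b⟩, ⟨hab, hba⟩, hmin⟩ := Set.exists_min_image
    {p : F × F | Q p.1 p.2 ∧ ¬ Q p.2 p.1}
    (fun p => (Finset.univ.filter fun z => Q p.1 z ∧ Q z p.2).card) (Set.toFinite _)
    ⟨(a, b), hab, hba⟩
  simp only at hab hba hmin
  have dich : ∀ z, Q a z → Q z b → ¬ Q b z → Q z a := by
    intro z haz hzb hbz
    by_contra hza
    have h := hmin (a, z) ⟨haz, hza⟩
    refine absurd h (not_le.mpr (Finset.card_lt_card ?_))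
    refine Finset.ssubset_iff_of_subset ?_ |>.mpr ⟨b, ?_, ?_⟩
    · intro w hw
      simp only [Finset.mem_filter, Finset.mem_univ, true_and] at hw ⊢
      exact ⟨hw.1, htrans _ _ _ hw.2 hzb⟩
    · simpa using ⟨hab, hrefl b⟩
    · simp [hbz]
  let W : F → Prop := fun z => Q a z ∧ Q z b
  have hWa : W a := ⟨hrefl a, hab⟩
  have hWb : W b := ⟨hab, hrefl b⟩
  have hWτ : ∀ y, (∀ j, W (y j)) → W (τ y) := fun y hy =>
    ⟨idem a ▸ hQ _ _ fun j => (hy j).1, idem b ▸ hQ _ _ fun j => (hy j).2⟩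
  have mono : ∀ y y', (∀ j, W (y j)) → (∀ j, W (y' j)) → (∀ j, Q b (y j) → Q b (y' j)) →
      Q b (τ y) → Q b (τ y') := by
    intro y y' hy hy' h hb
    refine htrans _ _ _ hb (hQ _ _ fun j => ?_)
    by_cases hj : Q b (y j)
    · exact htrans _ _ _ (hy j).2 (h j hj)
    · exact htrans _ _ _ (dich _ (hy j).1 (hy j).2 hj) (hy' j).1
  have hWu : ∀ (y : Fin n → F) i z, (∀ j, W (y j)) → W z → ∀ j, W (Function.update y i z j) := by
    intro y i z hy hz j
    by_cases hj : j = i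
    · subst hj; simpa using hz
    · simpa [hj] using hy j
  have monoU : ∀ (y : Fin n → F) i z z', (∀ j, W (y j)) → W z → W z' → (Q b z → Q b z') →
      Q b (τ (Function.update y i z)) → Q b (τ (Function.update y i z')) := by
    intro y i z z' hy hz hz' h
    refine mono _ _ (hWu y i z hy hz) (hWu y i z' hy hz') fun j => ?_
    by_cases hj : j = i
    · subst hj; simpa using h
    · simp [hj]
  have essential : ∀ (y y' : Fin n → F) (i : Fin n), (∀ j, W (y j)) → (∀ j, W (y' j)) →
      ¬ Q b (τ (Function.update y i a)) → Q b (τ (Function.update y i b)) →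
      ¬ Q b (τ (Function.update y' i a)) ∧ Q b (τ (Function.update y' i b)) := by
    intro y y' i hy hy' h0 h1
    obtain ⟨k, hk⟩ := exists_iterate_idempotent fun z => τ (Function.update y' i z)
    have hW' : ∀ m z, W z → W ((fun z => τ (Function.update y' i z))^[m] z) := by
      intro m
      induction m with
      | zero => exact fun z hz => hz
      | succ m ih => exact fun z hz => ih _ (hWτ _ (hWu y' i z hy' hz))
    have keep : ∀ m z, W z → (Q b ((fun z => τ (Function.update y i z))^[m] z) ↔ Q b z) := by
      intro m
      induction m with
      | zero => exact fun z hz => Iff.rfl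
      | succ m ih =>
        intro z hz
        rw [Function.iterate_succ_apply, ih _ (hWτ _ (hWu y i z hy hz))]
        constructor
        · intro h
          by_contra hbz
          exact h0 (monoU y i z a hy hz hWa (fun h => absurd h hbz) h)
        · intro h
          exact monoU y i b z hy hWb hz (fun _ => h) h1
    have contra : ∀ x, W x → (Q b ((fun z => τ (Function.update y' i z))^[k + 1] x) ↔ Q b x) := by
      intro x hx
      have h := tc i (k + 1) y' y _ _ (hk x)
      rw [← keep (k + 1) _ (hW' _ x hx), ← keep (k + 1) x hx, h]
    have hs : ∀ x, (fun z => τ (Function.update y' i z))^[k + 1] x =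
        τ (Function.update y' i ((fun z => τ (Function.update y' i z))^[k] x)) := fun x =>
      Function.iterate_succ_apply' _ _ _
    constructor
    · intro h
      refine hba ((contra a hWa).1 ?_)
      rw [hs]
      exact monoU y' i a _ hy' hWa (hW' _ _ hWa) (fun h => absurd h hba) h
    · by_contra h
      have h2 := (contra b hWb).2 (hrefl b)
      rw [hs] at h2
      exact h (monoU y' i _ b hy' (hW' _ _ hWb) hWb (fun _ => hrefl b) h2)
  -- some coordinate is essential
  have hex : ∃ (y : Fin n → F) (i : Fin n), (∀ j, W (y j)) ∧
      ¬ Q b (τ (Function.update y i a)) ∧ Q b (τ (Function.update y i b)) := by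
    by_contra hne
    push Not at hne
    have key : ∀ s : Finset (Fin n), ¬ Q b (τ (s.piecewise (fun _ => b) (fun _ => a))) := by
      intro s
      induction s using Finset.induction_on with
      | empty => simpa [idem] using hba
      | insert i s his ih =>
        rw [Finset.piecewise_insert]
        refine hne _ i (fun j => ?_) ?_
        · by_cases hj : j ∈ s
          · simpa [hj] using hWb
          · simpa [hj] using hWa
        · rwa [show Function.update (s.piecewise (fun _ => b) (fun _ => a)) i a =
            s.piecewise (fun _ => b) (fun _ => a) by rw [Function.update_eq_iff]; simp [his]]
    have := key Finset.univ
    simp [idem, hrefl] at this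
  obtain ⟨y, i, hy, h0, h1⟩ := hex
  have val : ∀ y' : Fin n → F, (∀ j, y' j = a ∨ y' j = b) → (Q b (τ y') ↔ y' i = b) := by
    intro y' hy'
    have h := essential y y' i hy
      (fun j => by rcases hy' j with h | h <;> rw [h]; exacts [hWa, hWb]) h0 h1
    have hne : a ≠ b := fun h => hba (h ▸ hrefl _)
    rcases hy' i with hi | hi
    · have h2 := h.1
      rw [show Function.update y' i a = y' by rw [← hi, Function.update_eq_self]] at h2
      simp [h2, hi, hne]
    · have h2 := h.2
      rw [show Function.update y' i b = y' by rw [← hi, Function.update_eq_self]] at h2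
      simp [h2, hi]
  have hne : a ≠ b := fun h => hba (h ▸ hrefl _)
  have e1 := val (fun j => if u i j = 0 then a else b) (fun j => by split_ifs <;> simp)
  have e2 := val (fun j => if v i j = 0 then a else b) (fun j => by split_ifs <;> simp)
  rw [taylor i a b, e2] at e1
  have := huv i
  by_cases hu : u i i = 0 <;> by_cases hv : v i i = 0
  · exact this (hu.trans hv.symm)
  · simp [hu, hv, hne] at e1
  · simp [hu, hv, hne] at e1
  · omega

/-- A clone of operations on `E` satisfying the term condition, in its symmetric form: the four
arguments form, in every coordinate, a matrix with equal rows or equal columns. -/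
structure AbelianClone (E : Type) where
  Op : ∀ {ι : Type}, ((ι → E) → E) → Prop
  proj : ∀ {ι : Type} (i : ι), Op fun v : ι → E => v i
  comp : ∀ {ι κ : Type} (f : (ι → E) → E) (g : ι → (κ → E) → E), Op f → (∀ i, Op (g i)) →
    Op fun v => f fun i => g i v
  tc : ∀ {ι : Type} [Finite ι] (f : (ι → E) → E), Op f → ∀ v w v' w' : ι → E,
    (∀ i, (v i = w i ∧ v' i = w' i) ∨ (v i = v' i ∧ w i = w' i)) → f v = f w → f v' = f w'

namespace AbelianClone

variable {E : Type} (C : AbelianClone E)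

def Op3 (p : E → E → E → E) : Prop := C.Op fun v : Fin 3 → E => p (v 0) (v 1) (v 2)

def Op4 (p : E → E → E → E → E) : Prop :=
  C.Op fun v : Fin 4 → E => p (v 0) (v 1) (v 2) (v 3)

variable {C}

theorem Op3.comp {p : E → E → E → E} (hp : C.Op3 p) {κ : Type} {a b c : (κ → E) → E}
    (ha : C.Op a) (hb : C.Op b) (hc : C.Op c) : C.Op fun v => p (a v) (b v) (c v) :=
  C.comp _ ![a, b, c] hp (by simp [Fin.forall_fin_succ, ha, hb, hc])

theorem Op4.comp {p : E → E → E → E → E} (hp : C.Op4 p) {κ : Type} {a b c d : (κ → E) → E}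
    (ha : C.Op a) (hb : C.Op b) (hc : C.Op c) (hd : C.Op d) :
    C.Op fun v => p (a v) (b v) (c v) (d v) :=
  C.comp _ ![a, b, c, d] hp (by simp [Fin.forall_fin_succ, ha, hb, hc, hd])

theorem op_iterate {κ : Type} (F : (κ → E) → E → E)
    (hF : ∀ s, C.Op s → C.Op fun v => F v (s v)) (k : ℕ) (s : (κ → E) → E) (hs : C.Op s) :
    C.Op fun v => (F v)^[k] (s v) := by
  induction k generalizing s with
  | zero => exact hs
  | succ k ih => exact ih _ (hF s hs)

variable (C)

/-- A ternary operation satisfying one of the two Maltsev identities, for which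
`z ↦ p y y z` is a retraction. -/
structure IsHalfMaltsev (p : E → E → E → E) : Prop where
  op : C.Op3 p
  right : ∀ x y, p x y y = x
  idem : ∀ y z, p y y (p y y z) = p y y z

/-- The kernel of an operation in its third coordinate. -/
def Ker (p : E → E → E → E) (a b : E) : Prop := ∀ x y, p x y a = p x y b

variable {C}

theorem ker_of_eq {p : E → E → E → E} (hp : C.Op3 p) {x y a b : E} (h : p x y a = p x y b) :
    Ker p a b := fun x' y' =>
  C.tc _ hp ![x, y, a] ![x, y, b] ![x', y', a] ![x', y', b] (by simp [Fin.forall_fin_succ]) h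

theorem Ker.symm {p : E → E → E → E} {a b : E} (h : Ker p a b) : Ker p b a :=
  fun x y => (h x y).symm

theorem Ker.trans {p : E → E → E → E} {a b c : E} (h : Ker p a b) (h' : Ker p b c) :
    Ker p a c := fun x y => (h x y).trans (h' x y)

theorem Ker.refl (p : E → E → E → E) (a : E) : Ker p a a := fun _ _ => rfl

namespace IsHalfMaltsev

variable {p : E → E → E → E} (hp : C.IsHalfMaltsev p)
include hp

theorem ker_retract (y z : E) : Ker p (p y y z) z := ker_of_eq hp.op (hp.idem y z)

theorem eq_of_ker {y z : E} (h : Ker p z y) : p z z y = z := by rw [← h, hp.right]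

theorem cross (x y : E) : p (p x x y) y x = x := by
  have hcl : C.Op fun v : Fin 3 → E => p (p (v 0) (v 0) (v 1)) (v 1) (v 2) :=
    hp.op.comp (hp.op.comp (C.proj 0) (C.proj 0) (C.proj 1)) (C.proj 1) (C.proj 2)
  have h : p (p x x x) x y = p (p x x y) y y := by rw [hp.right, hp.right]
  have h' : p (p x x x) x x = p (p x x y) y x :=
    C.tc _ hcl ![x, x, y] ![x, y, y] ![x, x, x] ![x, y, x] (by simp [Fin.forall_fin_succ]) h
  rw [← h', hp.right, hp.right]

theorem ker_left {a b : E} (h : Ker p a b) (y z : E) : Ker p (p a y z) (p b y z) := by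
  have hcl : C.Op fun v : Fin 4 → E => p (v 0) (v 0) (p (v 1) (v 2) (v 3)) :=
    hp.op.comp (C.proj 0) (C.proj 0) (hp.op.comp (C.proj 1) (C.proj 2) (C.proj 3))
  have h0 : p y y (p a y y) = p y y (p b y y) := by rw [hp.right, hp.right, h]
  exact ker_of_eq hp.op (C.tc _ hcl ![y, a, y, y] ![y, b, y, y] ![y, a, y, z] ![y, b, y, z]
    (by simp [Fin.forall_fin_succ]) h0)

end IsHalfMaltsev

/-- If the kernel of a half-Maltsev operation is nontrivial, then there is an operation that acts
on each kernel class as a half-Maltsev operation, and that is not nilpotent there. -/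
theorem exists_local_half [Finite E] {n : ℕ} (t : (Fin n → E) → E) (ht : C.Op t)
    (idem : ∀ a, t (fun _ => a) = a)
    (u v : Fin n → Fin n → Fin 2) (huv : ∀ i, u i i ≠ v i i)
    (taylor : ∀ i x y, t (fun j => if u i j = 0 then x else y) =
      t (fun j => if v i j = 0 then x else y))
    {p : E → E → E → E} (hp : C.IsHalfMaltsev p) {y₀ b₀ : E} (hk : Ker p b₀ y₀)
    (hne : y₀ ≠ b₀) :
    ∃ P : E → E → E → E → E, C.Op4 P ∧ (∀ y a b c, Ker p (P y a b c) y) ∧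
      (∀ y a b, Ker p a y → Ker p b y → P y a b b = a) ∧
      ∃ y x x' z, Ker p x y ∧ Ker p x' y ∧ Ker p z y ∧ x ≠ x' ∧ P y x x z = P y x' x' z := by
  classical
  let F := {g : E → E → E → E // C.Op3 g ∧ (∀ y a b, Ker p (g y a b) y) ∧
    ∀ y x, g y x x = p x x y}
  let τ : (Fin n → F) → F := fun g =>
    ⟨fun y a b => p (t fun j => (g j).1 y a b) (t fun j => (g j).1 y a b) y, by
      have h : C.Op fun v : Fin 3 → E => t fun j => (g j).1 (v 0) (v 1) (v 2) :=
        C.comp _ (fun j (v : Fin 3 → E) => (g j).1 (v 0) (v 1) (v 2)) ht fun j => (g j).2.1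
      exact hp.op.comp h h (C.proj 0),
     fun y a b => hp.ker_retract _ _, fun y x => by
      simp only [(g _).2.2.2, idem]
      exact hp.eq_of_ker (hp.ker_retract _ _)⟩
  let R : F → F → Prop := fun g g' => ∃ H : E → E → E → E → E, C.Op4 H ∧
    (∀ y a b c, Ker p (H y a b c) y) ∧ (∀ y x, H y x x x = p x x y) ∧
    (∀ y a b, g.1 y a b = H y a b b) ∧ (∀ y a b, g'.1 y a b = H y a a b)
  have hRrefl : ∀ g, R g g := fun g => ⟨fun y a _ c => g.1 y a c,
    g.2.1.comp (C.proj 0) (C.proj 1) (C.proj 3), fun y a _ c => g.2.2.1 y a c, g.2.2.2,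
    fun _ _ _ => rfl, fun _ _ _ => rfl⟩
  have hRτ : ∀ a b : Fin n → F, (∀ i, R (a i) (b i)) → R (τ a) (τ b) := by
    intro a b hab
    choose H h1 h2 h3 h4 h5 using hab
    refine ⟨fun y a b c => p (t fun j => H j y a b c) (t fun j => H j y a b c) y, ?_,
      fun y a b c => hp.ker_retract _ _, fun y x => ?_, fun y c d => ?_, fun y c d => ?_⟩
    · have h : C.Op fun v : Fin 4 → E => t fun j => H j (v 0) (v 1) (v 2) (v 3) :=
        C.comp _ (fun j (v : Fin 4 → E) => H j (v 0) (v 1) (v 2) (v 3)) ht h1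
      exact hp.op.comp h h (C.proj 0)
    · simp only [h3, idem]
      exact hp.eq_of_ker (hp.ker_retract _ _)
    · simp only [τ, h4]
    · simp only [τ, h5]
  have hiter : ∀ (i : Fin n) (k : ℕ) (Y : Fin n → F) (x : F) (y a b : E),
      ((fun z => τ (Function.update Y i z))^[k] x).1 y a b =
      (fun z => p (t (Function.update (fun j => (Y j).1 y a b) i z))
        (t (Function.update (fun j => (Y j).1 y a b) i z)) y)^[k] (x.1 y a b) := by
    intro i k Y x y a b
    induction k generalizing x with
    | zero => rfl
    | succ k ih =>
      rw [Function.iterate_succ_apply, ih, Function.iterate_succ_apply]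
      have : (fun j => (Function.update Y i x j).1 y a b) =
          Function.update (fun j => (Y j).1 y a b) i (x.1 y a b) := by
        funext j
        by_cases hj : j = i
        · subst hj; simp
        · simp [hj]
      simp only [τ, this]
  have tcF : ∀ (i : Fin n) (k : ℕ) (Y Y' : Fin n → F) (x x' : F),
      (fun z => τ (Function.update Y i z))^[k] x = (fun z => τ (Function.update Y i z))^[k] x' →
      (fun z => τ (Function.update Y' i z))^[k] x =
        (fun z => τ (Function.update Y' i z))^[k] x' := by
    intro i k Y Y' x x' h
    refine Subtype.ext (funext fun y => funext fun a => funext fun b => ?_)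
    have h' := congrArg (fun g : F => g.1 y a b) h
    simp only [hiter] at h' ⊢
    have hcl : C.Op fun v : Fin n ⊕ Fin 2 → E =>
        (fun z => p (t (Function.update (fun j => v (.inl j)) i z))
          (t (Function.update (fun j => v (.inl j)) i z)) (v (.inr 1)))^[k] (v (.inr 0)) := by
      refine op_iterate (fun (v : Fin n ⊕ Fin 2 → E) z =>
        p (t (Function.update (fun j => v (.inl j)) i z))
          (t (Function.update (fun j => v (.inl j)) i z)) (v (.inr 1))) (fun s hs => ?_) k _
        (C.proj _)
      have h : C.Op fun v : Fin n ⊕ Fin 2 → E =>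
          t (Function.update (fun j => v (.inl j)) i (s v)) := by
        have := C.comp t (fun j (v : Fin n ⊕ Fin 2 → E) => if j = i then s v else v (.inl j)) ht
          (fun j => by
            by_cases hj : j = i
            · simpa [hj] using hs
            · simpa [hj] using C.proj _)
        convert this using 4 with w j
        rw [Function.update_apply]
      exact hp.op.comp h h (C.proj _)
    exact C.tc _ hcl (Sum.elim (fun j => (Y j).1 y a b) ![x.1 y a b, y])
      (Sum.elim (fun j => (Y j).1 y a b) ![x'.1 y a b, y])
      (Sum.elim (fun j => (Y' j).1 y a b) ![x.1 y a b, y])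
      (Sum.elim (fun j => (Y' j).1 y a b) ![x'.1 y a b, y])
      (by simp) h'
  have idemF : ∀ g : F, τ (fun _ => g) = g := fun g =>
    Subtype.ext (funext fun y => funext fun a => funext fun b => by
      simp only [τ, idem]
      exact hp.eq_of_ker (g.2.2.1 y a b))
  have taylorF : ∀ i (X Y : F), τ (fun j => if u i j = 0 then X else Y) =
      τ (fun j => if v i j = 0 then X else Y) := fun i X Y =>
    Subtype.ext (funext fun y => funext fun a => funext fun b => by
      have := taylor i (X.1 y a b) (Y.1 y a b)
      have e : ∀ w : Fin n → Fin 2, (fun j => (if w j = 0 then X else Y : F).1 y a b) =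
          fun j => if w j = 0 then X.1 y a b else Y.1 y a b := fun w => by
        funext j; split_ifs <;> rfl
      simp only [τ, e, this])
  let X₁ : F := ⟨fun y a _ => p a a y, hp.op.comp (C.proj 1) (C.proj 1) (C.proj 0),
    fun y a _ => hp.ker_retract _ _, fun _ _ => rfl⟩
  let X₂ : F := ⟨fun y _ b => p b b y, hp.op.comp (C.proj 2) (C.proj 2) (C.proj 0),
    fun y _ b => hp.ker_retract _ _, fun _ _ => rfl⟩
  have hR21 : R X₂ X₁ := ⟨fun y _ b _ => p b b y,
    hp.op.comp (C.proj 2) (C.proj 2) (C.proj 0), fun y _ b _ => hp.ker_retract _ _,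
    fun _ _ => rfl, fun _ _ _ => rfl, fun _ _ _ => rfl⟩
  have hQ12 : Relation.ReflTransGen R X₁ X₂ :=
    compatible_quasiorder_symm τ idemF u v huv taylorF tcF (Relation.ReflTransGen R)
      (fun _ => .refl) (fun _ _ _ => .trans) (reflTransGen_compatible τ R hRrefl hRτ) X₂ X₁
      (.single hR21)
  let Inv : F → Prop := fun g => ∀ y b, Ker p b y → ∀ x x', Ker p x y → Ker p x' y →
    g.1 y x b = g.1 y x' b → x = x'
  have hI1 : Inv X₁ := fun y b _ x x' hx hx' h => by
    rwa [show X₁.1 y x b = x from hp.eq_of_ker hx,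
      show X₁.1 y x' b = x' from hp.eq_of_ker hx'] at h
  have hI2 : ¬ Inv X₂ := fun h => hne (h y₀ y₀ (.refl p _) y₀ b₀ (.refl p _) hk rfl)
  obtain ⟨g, g', ⟨H, hH, hHy, hHx, hg, hg'⟩, hIg, hIg'⟩ :
      ∃ g g', R g g' ∧ Inv g ∧ ¬ Inv g' := by
    by_contra hno
    push Not at hno
    have hI : ∀ g, Relation.ReflTransGen R X₁ g → Inv g := fun g hg => by
      induction hg with
      | refl => exact hI1
      | tail _ h ih => exact hno _ _ h ih
    exact hI2 (hI X₂ hQ12)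
  obtain ⟨k, hkk⟩ := exists_iterate_idempotent
    fun w : E × E × E => (w.1, H w.1 w.2.1 w.2.2 w.2.2, w.2.2)
  have hit : ∀ m (y x b : E), (fun w : E × E × E => (w.1, H w.1 w.2.1 w.2.2 w.2.2, w.2.2))^[m]
      (y, x, b) = (y, (fun z => H y z b b)^[m] x, b) := by
    intro m y x b
    induction m generalizing x with
    | zero => rfl
    | succ m ih => rw [Function.iterate_succ_apply, ih, Function.iterate_succ_apply]
  have hid : ∀ y x b, Ker p x y → Ker p b y → (fun z => H y z b b)^[k + 1] x = x := by
    intro y x b hx hb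
    have hKer : ∀ m x, Ker p x y → Ker p ((fun z => H y z b b)^[m] x) y := by
      intro m
      induction m with
      | zero => exact fun x hx => hx
      | succ m ih => exact fun x hx => ih _ (hHy _ _ _ _)
    have hinj : ∀ m x x', Ker p x y → Ker p x' y → (fun z => H y z b b)^[m] x =
        (fun z => H y z b b)^[m] x' → x = x' := by
      intro m
      induction m with
      | zero => exact fun x x' _ _ h => h
      | succ m ih =>
        intro x x' hx hx' h
        refine hIg y b hb x x' hx hx' ?_
        rw [hg, hg]
        exact ih _ _ (hHy _ _ _ _) (hHy _ _ _ _) h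
    have h := hkk (y, x, b)
    rw [hit, hit] at h
    exact hinj (k + 1) _ _ (hKer _ _ hx) hx (congrArg (fun w : E × E × E => w.2.1) h)
  have hfix : ∀ y x, Ker p x y → (fun z => H y z x x)^[k] x = x := fun y x hx =>
    Function.iterate_fixed (f := fun z => H y z x x) ((hHx y x).trans (hp.eq_of_ker hx)) k
  refine ⟨fun y a b c => H y ((fun z => H y z b b)^[k] a) b c, ?_, fun y a b c => hHy _ _ _ _,
    fun y a b ha hb => ?_, ?_⟩
  · refine hH.comp (C.proj 0) ?_ (C.proj 2) (C.proj 3)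
    exact op_iterate (fun (v : Fin 4 → E) z => H (v 0) z (v 2) (v 2))
      (fun s hs => hH.comp (C.proj 0) hs (C.proj 2) (C.proj 2)) k _ (C.proj 1)
  · have := hid y a b ha hb
    rwa [Function.iterate_succ_apply'] at this
  · simp only [Inv] at hIg'
    push Not at hIg'
    obtain ⟨y, b, hb, x, x', hx, hx', he, hxx⟩ := hIg'
    refine ⟨y, x, x', b, hx, hx', hb, hxx, ?_⟩
    simp only [hfix y x hx, hfix y x' hx', ← hg', he]

/-- A finite idempotent abelian algebra with a Taylor operation has a Maltsev operation. -/
theorem exists_maltsev [Finite E] {n : ℕ} (t : (Fin n → E) → E) (ht : C.Op t)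
    (idem : ∀ a, t (fun _ => a) = a)
    (u v : Fin n → Fin n → Fin 2) (huv : ∀ i, u i i ≠ v i i)
    (taylor : ∀ i x y, t (fun j => if u i j = 0 then x else y) =
      t (fun j => if v i j = 0 then x else y)) :
    ∃ p : E → E → E → E, C.Op3 p ∧ (∀ x y, p x y y = x) ∧ ∀ x y, p y y x = x := by
  classical
  obtain ⟨p, hp, hmin⟩ := Set.exists_min_image {p | C.IsHalfMaltsev p}
    (fun p => {w : E × E | Ker p w.1 w.2}.ncard) (Set.toFinite _)
    ⟨fun x _ _ => x, C.proj 0, fun _ _ => rfl, fun _ _ => rfl⟩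
  simp only [Set.mem_ofPred_eq] at hp hmin
  refine ⟨p, hp.op, hp.right, fun z y => ?_⟩
  by_contra hyz
  obtain ⟨P, hP, hPy, hPr, y₁, x, x', z₀, hx, hx', hz₀, hxx, hPxx⟩ :=
    exists_local_half t ht idem u v huv taylor hp (hp.ker_retract y z) (fun h => hyz h.symm)
  have pyyy : ∀ y, p y y y = y := fun y => hp.right y y
  let p₃ : E → E → E → E := fun x y z => p (P y (p x x y) y (p z z y)) y x
  let p₄ : E → E → E → E := fun x y z => p (p₃ x y z) y z
  have hp₃ : C.Op3 p₃ :=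
    hp.op.comp (hP.comp (C.proj 1) (hp.op.comp (C.proj 0) (C.proj 0) (C.proj 1)) (C.proj 1)
      (hp.op.comp (C.proj 2) (C.proj 2) (C.proj 1))) (C.proj 1) (C.proj 0)
  have hp₄ : C.Op3 p₄ := hp.op.comp hp₃ (C.proj 1) (C.proj 2)
  have right₄ : ∀ x y, p₄ x y y = x := by
    intro x y
    simp only [p₄, p₃, hp.right]
    rw [hPr y _ y (hp.ker_retract _ _) (.refl p y), hp.cross]
  have local₄ : ∀ y z, Ker p z y → p₄ y y z = P y y y z := by
    intro y z hz
    simp only [p₄, p₃]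
    rw [hz, hp.right, hp.right, pyyy, hp.eq_of_ker hz]
  have ker₃ : ∀ x y z, Ker p (p₃ x y z) x := fun x y z =>
    (hp.ker_left (hPy _ _ _ _) y x).trans (hp.ker_retract y x)
  have ker₄ : ∀ y z, Ker p (p₄ y y z) z := fun y z =>
    (hp.ker_left (ker₃ y y z) y z).trans (hp.ker_retract y z)
  obtain ⟨k, hk⟩ := exists_iterate_idempotent fun w : E × E => (w.1, p₄ w.1 w.1 w.2)
  have hit : ∀ m (y z : E), (fun w : E × E => (w.1, p₄ w.1 w.1 w.2))^[m] (y, z) =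
      (y, (fun z => p₄ y y z)^[m] z) := by
    intro m y z
    induction m generalizing z with
    | zero => rfl
    | succ m ih => rw [Function.iterate_succ_apply, ih, Function.iterate_succ_apply]
  let p₅ : E → E → E → E := fun x y z => p₄ x y ((fun z => p₄ y y z)^[k] z)
  have hp₅q : ∀ y z, p₅ y y z = (fun z => p₄ y y z)^[k + 1] z := fun y z =>
    (Function.iterate_succ_apply' (fun z => p₄ y y z) k z).symm
  have hp₅ : C.IsHalfMaltsev p₅ := by
    refine ⟨hp₄.comp (C.proj 0) (C.proj 1) ?_, fun x y => ?_, fun y z => ?_⟩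
    · exact op_iterate (fun (v : Fin 3 → E) z => p₄ (v 1) (v 1) z)
        (fun s hs => hp₄.comp (C.proj 1) (C.proj 1) hs) k _ (C.proj 2)
    · simp only [p₅]
      rw [Function.iterate_fixed (right₄ y y), right₄]
    · rw [hp₅q, hp₅q]
      have h := hk (y, z)
      rw [hit, hit] at h
      exact congrArg Prod.snd h
  have ker₅ : ∀ m y z, Ker p ((fun z => p₄ y y z)^[m] z) z := by
    intro m y
    induction m with
    | zero => exact fun z => .refl p z
    | succ m ih => exact fun z => (ih _).trans (ker₄ y z)
  have hsub : {w : E × E | Ker p₅ w.1 w.2} ⊆ {w : E × E | Ker p w.1 w.2} := by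
    rintro ⟨a, b⟩ h
    have h1 : p₅ a a a = p₅ a a b := h a a
    rw [hp₅q, hp₅q] at h1
    have h2 := ker₅ (k + 1) a a
    rw [h1] at h2
    exact h2.symm.trans (ker₅ (k + 1) a b)
  have heq := Set.eq_of_subset_of_ncard_le hsub (hmin p₅ hp₅) (Set.toFinite _)
  have hker : ∀ a b, Ker p a b → Ker p₅ a b := fun a b h => by
    have : (a, b) ∈ {w : E × E | Ker p w.1 w.2} := h
    rwa [← heq] at this
  have hnil : ∀ y z, Ker p z y → (fun z => P y y y z)^[k + 1] z = y := by
    intro y z hz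
    have h : p₅ y y z = y := (hker z y hz y y).trans (hp₅.right y y)
    rw [hp₅q] at h
    have : ∀ m z, Ker p z y → (fun z => P y y y z)^[m] z = (fun z => p₄ y y z)^[m] z := by
      intro m
      induction m with
      | zero => exact fun _ _ => rfl
      | succ m ih =>
        intro z hz
        rw [Function.iterate_succ_apply, Function.iterate_succ_apply, ih _ (hPy _ _ _ _),
          local₄ y z hz]
    exact (this _ z hz).trans h
  have hPyx : ∀ y x, Ker p x y → P y x x x = x := fun y x hx => hPr y x x hx hx
  have hcl : C.Op fun v : Fin 3 → E => (fun z => P (v 0) (v 1) (v 1) z)^[k + 1] (v 2) :=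
    op_iterate (fun (v : Fin 3 → E) z => P (v 0) (v 1) (v 1) z)
      (fun s hs => hP.comp (C.proj 0) (C.proj 1) (C.proj 1) hs) (k + 1) _ (C.proj 2)
  have hnil' : ∀ x, Ker p x y₁ → (fun z => P y₁ x x z)^[k + 1] z₀ = x := by
    intro x hx
    have h1 : (fun z => P y₁ y₁ y₁ z)^[k + 1] z₀ = (fun z => P y₁ y₁ y₁ z)^[k + 1] x := by
      rw [hnil y₁ z₀ hz₀, hnil y₁ x hx]
    have h2 : (fun z => P y₁ x x z)^[k + 1] z₀ = (fun z => P y₁ x x z)^[k + 1] x :=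
      C.tc _ hcl ![y₁, y₁, z₀] ![y₁, y₁, x] ![y₁, x, z₀] ![y₁, x, x]
        (by simp [Fin.forall_fin_succ]) h1
    rw [h2, Function.iterate_fixed (hPyx y₁ x hx)]
  have hall : ∀ z, P y₁ x x z = P y₁ x' x' z := fun z =>
    C.tc _ hP ![y₁, x, x, z₀] ![y₁, x', x', z₀] ![y₁, x, x, z] ![y₁, x', x', z]
      (by simp [Fin.forall_fin_succ]) hPxx
  refine hxx ?_
  rw [← hnil' x hx, ← hnil' x' hx', show (fun z => P y₁ x x z) = fun z => P y₁ x' x' z from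
    funext hall]

end AbelianClone

section TermOperations

variable {S : Signature} {A : Type} [SAlg S A]

/-- Term operations of an algebra in an arbitrary set of variables. -/
inductive TermOp (S : Signature) {A : Type} [SAlg S A] {ι : Type} : ((ι → A) → A) → Prop
  | proj (i : ι) : TermOp S fun v => v i
  | app (o : S.ops) (gs : Fin (S.arity o) → (ι → A) → A) (h : ∀ i, TermOp S (gs i)) :
    TermOp S fun v => SAlg.interp o fun i => gs i v

theorem TermOp.comp {ι κ : Type} {f : (ι → A) → A} (hf : TermOp S f) (g : ι → (κ → A) → A)
    (hg : ∀ i, TermOp S (g i)) : TermOp S fun v => f fun i => g i v := by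
  induction hf with
  | proj i => exact hg i
  | app o gs _ ih => exact .app o (fun i v => gs i fun j => g j v) ih

theorem STerm.termOp {m : ℕ} (t : STerm S m) : TermOp S (t.eval : (Fin m → A) → A) := by
  induction t with
  | var i => exact .proj i
  | app o ts ih => exact .app o (fun i => (ts i).eval) ih

theorem TermOp.exists_term {ι : Type} {g : (ι → A) → A} (hg : TermOp S g) {m : ℕ}
    (κ : ι → Fin m) : ∃ t : STerm S m, ∀ v : Fin m → A, t.eval v = g (v ∘ κ) := by
  induction hg with
  | proj i => exact ⟨.var (κ i), fun _ => rfl⟩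
  | app o gs _ ih =>
    choose t ht using ih
    exact ⟨.app o t, fun v => by simp only [STerm.eval, ht]⟩

theorem TermOp.exists_term_cons {ι : Type} [Finite ι] [DecidableEq ι] {g : (ι → A) → A}
    (hg : TermOp S g) (i : ι) : ∃ (m : ℕ) (t : STerm S (m + 1)) (κ : Fin m → ι),
      ∀ a (c : ι → A), t.eval (Fin.cons a (c ∘ κ)) = g (Function.update c i a) := by
  obtain ⟨m, ⟨e⟩⟩ := Finite.exists_equiv_fin ι
  obtain ⟨t, ht⟩ := hg.exists_term (fun j => if j = i then (0 : Fin (m + 1)) else (e j).succ)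
  refine ⟨m, t, e.symm, fun a c => ?_⟩
  rw [ht]
  congr 1
  funext j
  by_cases hj : j = i
  · subst hj; simp
  · simp [hj]

theorem TermOp.congruence {ι : Type} {g : (ι → A) → A} (hg : TermOp S g) {θ : Set (A × A)}
    (hθ : IsSubuniverse S θ) {v w : ι → A} (h : ∀ i, (v i, w i) ∈ θ) : (g v, g w) ∈ θ := by
  induction hg with
  | proj i => exact h i
  | app o gs _ ih => exact hθ o (fun i => (gs i v, gs i w)) ih

/-- The term condition for the centralizer relation, in its symmetric form. -/
theorem TermOp.rectangle {ι : Type} [Finite ι] {g : (ι → A) → A} (hg : TermOp S g)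
    {μ ρ : Set (A × A)} (hab : Centralizes S μ μ ρ) {v w v' w' : ι → A}
    (hvw : ∀ i, (v i, w i) ∈ μ) (hvw' : ∀ i, (v' i, w' i) ∈ μ) (hvv : ∀ i, (v i, v' i) ∈ μ)
    (h : ∀ i, (v i = w i ∧ v' i = w' i) ∨ (v i = v' i ∧ w i = w' i))
    (hρ : (g v, g w) ∈ ρ) : (g v', g w') ∈ ρ := by
  classical
  have := Fintype.ofFinite ι
  have key : ∀ s : Finset ι, (g (s.piecewise v' v), g (s.piecewise w' w)) ∈ ρ := by
    intro s
    induction s using Finset.induction_on with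
    | empty => simpa using hρ
    | insert i s his ih =>
      obtain ⟨m, t, κ, ht⟩ := hg.exists_term_cons i
      rw [Finset.piecewise_insert, Finset.piecewise_insert]
      rcases h i with ⟨h1, h2⟩ | ⟨h1, h2⟩
      · rw [← h2, ← ht, ← ht]
        refine hab m t (v i) (v' i) _ _ (hvv i) (fun j => ?_) ?_
        · by_cases hj : κ j ∈ s
          · simpa [hj] using hvw' _
          · simpa [hj] using hvw _
        · rw [ht, ht]
          rwa [show Function.update (s.piecewise v' v) i (v i) = s.piecewise v' v by
            rw [Function.update_eq_iff]; simp [his],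
            show Function.update (s.piecewise w' w) i (v i) = s.piecewise w' w by
            rw [Function.update_eq_iff]; simp [his, h1]]
      · rw [← h1, ← h2]
        rwa [show Function.update (s.piecewise v' v) i (v i) = s.piecewise v' v by
            rw [Function.update_eq_iff]; simp [his],
            show Function.update (s.piecewise w' w) i (w i) = s.piecewise w' w by
            rw [Function.update_eq_iff]; simp [his]]
  simpa using key Finset.univ

end TermOperations

section DifferenceTerm

variable {S : Signature} {A : Type} [SAlg S A]

/-- The choice functions that pick, in each class of `μ`, a distinguished representative of a class
of `ρ`. -/
abbrev Section (μ : Set (A × A)) (r : A → A) : Type :=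
  {X : A → A // ∀ b, (b, X b) ∈ μ ∧ r (X b) = X b}

/-- The clone induced by the term operations on the choice functions of an abelian quotient. -/
def sectionClone {μ ρ : Set (A × A)} (hμ : IsCongruence S μ) (hρ : IsCongruence S ρ)
    (hab : Centralizes S μ μ ρ) (r : A → A) (hr : ∀ a b, r a = r b ↔ (a, b) ∈ ρ)
    (hrr : ∀ a, (r a, a) ∈ ρ) :
    AbelianClone (Section μ r) where
  Op f := ∃ g, TermOp S g ∧ ∀ X b, (f X).1 b = r (g fun i => (X i).1 b)
  proj i := ⟨_, .proj i, fun X b => ((X i).2 b).2.symm⟩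
  comp f g := by
    rintro ⟨f', hf', hf⟩ hg
    choose g' hg' hg using hg
    refine ⟨_, hf'.comp g' hg', fun X b => ?_⟩
    rw [hf, hr]
    refine hf'.congruence hρ.1 fun i => ?_
    rw [hg]
    exact hrr _
  tc f := by
    rintro ⟨g, hg, hf⟩ v w v' w' h he
    have hμs : ∀ (X Y : Section μ r) b, (X.1 b, Y.1 b) ∈ μ := fun X Y b =>
      hμ.2.trans (hμ.2.symm (X.2 b).1) (Y.2 b).1
    refine Subtype.ext (funext fun b => ?_)
    have hb := congrArg (fun X => X.1 b) he
    simp only [hf, hr] at hb ⊢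
    refine hg.rectangle hab (fun i => hμs _ _ b) (fun i => hμs _ _ b) (fun i => hμs _ _ b)
      (fun i => ?_) hb
    rcases h i with ⟨h1, h2⟩ | ⟨h1, h2⟩
    · exact .inl ⟨by rw [h1], by rw [h2]⟩
    · exact .inr ⟨by rw [h1], by rw [h2]⟩

/-- A finite algebra with a Taylor term has a term which is Maltsev on the classes of every
abelian quotient of congruences. -/
theorem exists_difference_term [Finite A] {n : ℕ} (t : STerm S n) (u v : Fin n → Fin n → Fin 2)
    (huv : ∀ i, u i i ≠ v i i) (ht : TaylorOn S A t u v) {μ ρ : Set (A × A)}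
    (hμ : IsCongruence S μ) (hρ : IsCongruence S ρ) (hle : ρ ⊆ μ) (hab : Centralizes S μ μ ρ) :
    ∃ d : STerm S 3, ∀ x y : A, (x, y) ∈ μ →
      (d.eval ![x, y, y], x) ∈ ρ ∧ (d.eval ![y, y, x], x) ∈ ρ := by
  classical
  let s : Setoid A := ⟨fun a b => (a, b) ∈ ρ, hρ.2⟩
  let r : A → A := fun a => (Quotient.mk s a).out
  have hrr : ∀ a, (r a, a) ∈ ρ := fun a => Quotient.mk_out (s := s) a
  have hr : ∀ a b, r a = r b ↔ (a, b) ∈ ρ := fun a b =>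
    ⟨fun h => hρ.2.trans (hρ.2.symm (hrr a)) (h ▸ hrr b), fun h => by
      simp only [r]; rw [Quotient.sound (s := s) h]⟩
  let τ : (Fin n → Section μ r) → Section μ r := fun X =>
    ⟨fun b => r (t.eval fun i => (X i).1 b), fun b => ⟨by
      have h := t.termOp.congruence hμ.1 (v := fun _ => b) fun i => ((X i).2 b).1
      rw [ht.1] at h
      exact hμ.2.trans h (hμ.2.symm (hle (hrr _))), (hr _ _).2 (hrr _)⟩⟩
  obtain ⟨p, ⟨g, hg, hpg⟩, hp1, hp2⟩ := AbelianClone.exists_maltsev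
    (C := sectionClone hμ hρ hab r hr hrr) τ ⟨_, t.termOp, fun _ _ => rfl⟩
    (fun X => Subtype.ext (funext fun b => by simp only [τ, ht.1, (X.2 b).2])) u v huv
    (fun i X Y => Subtype.ext (funext fun b => by
      have := ht.2 i (X.1 b) (Y.1 b)
      have e : ∀ w : Fin n → Fin 2,
          (fun j => (if w j = 0 then X else Y : Section μ r).1 b) =
          fun j => if w j = 0 then X.1 b else Y.1 b := fun w => by
        funext j; split_ifs <;> rfl
      simp only [τ, e, this]))
  obtain ⟨d, hd⟩ := hg.exists_term id
  simp only [Function.comp_id] at hd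
  let X : A → Section μ r := fun z => ⟨fun b => if (b, z) ∈ μ then r z else r b, fun b => by
    beta_reduce
    split_ifs with h
    · exact ⟨hμ.2.trans h (hμ.2.symm (hle (hrr z))), (hr _ _).2 (hrr _)⟩
    · exact ⟨hμ.2.symm (hle (hrr b)), (hr _ _).2 (hrr _)⟩⟩
  have hdr : ∀ x y z : A, (r (d.eval ![r x, r y, r z])) = r (d.eval ![x, y, z]) := fun x y z =>
    (hr _ _).2 (d.termOp.congruence hρ.1 (by simp [Fin.forall_fin_succ, hrr]))
  refine ⟨d, fun x y hxy => ?_⟩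
  have hX : ∀ z, (x, z) ∈ μ → (X z).1 x = r z := fun z hz => if_pos hz
  have hpx : ∀ a b c, (x, a) ∈ μ → (x, b) ∈ μ → (x, c) ∈ μ →
      (p (X a) (X b) (X c)).1 x = r (d.eval ![a, b, c]) := by
    intro a b c ha hb hc
    rw [← hdr, ← hX a ha, ← hX b hb, ← hX c hc, hd]
    rw [show p (X a) (X b) (X c) = (fun v : Fin 3 → Section μ r => p (v 0) (v 1) (v 2))
      ![X a, X b, X c] from rfl, hpg]
    congr 2
    funext i
    fin_cases i <;> rfl
  have hxx := hμ.2.refl x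
  have h1 := hpx x y y hxx hxy hxy
  have h2 := hpx y y x hxy hxy hxx
  rw [hp1, hX x hxx] at h1
  rw [hp2, hX x hxx] at h2
  exact ⟨(hr _ _).1 h1.symm, (hr _ _).1 h2.symm⟩

end DifferenceTerm

section Syntactic

variable {S : Signature} {A : Type} [SAlg S A]

/-- The pair `(ρ, μ)` is an abelian interval of congruences having a difference term. -/
structure AbelianInterval (S : Signature) {A : Type} [SAlg S A] (ρ μ : Set (A × A)) : Prop where
  bot : IsCongruence S ρ
  top : IsCongruence S μ
  le : ρ ⊆ μ
  abelian : Centralizes S μ μ ρ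
  diff : ∃ d : STerm S 3, ∀ x y : A, (x, y) ∈ μ →
    (d.eval ![x, y, y], x) ∈ ρ ∧ (d.eval ![y, y, x], x) ∈ ρ

/-- The syntactic congruence of `ρ` in the algebra `A(μ)`, on arbitrary pairs. -/
def Syn (S : Signature) {A : Type} [SAlg S A] (ρ μ : Set (A × A)) (p q : A × A) : Prop :=
  ∀ (m : ℕ) (t : STerm S (m + 1)) (c d : Fin m → A), (∀ i, (c i, d i) ∈ μ) →
    ((t.eval (Fin.cons p.1 c), t.eval (Fin.cons p.2 d)) ∈ ρ ↔
      (t.eval (Fin.cons q.1 c), t.eval (Fin.cons q.2 d)) ∈ ρ)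

variable {ρ μ : Set (A × A)}

theorem Syn.refl (p : A × A) : Syn S ρ μ p p := fun _ _ _ _ _ => Iff.rfl

theorem Syn.symm {p q : A × A} (h : Syn S ρ μ p q) : Syn S ρ μ q p :=
  fun m t c d hcd => (h m t c d hcd).symm

theorem Syn.trans {p q r : A × A} (h : Syn S ρ μ p q) (h' : Syn S ρ μ q r) : Syn S ρ μ p r :=
  fun m t c d hcd => (h m t c d hcd).trans (h' m t c d hcd)

theorem Syn.mem_iff {p q : A × A} (h : Syn S ρ μ p q) : p ∈ ρ ↔ q ∈ ρ :=
  h 0 (.var 0) Fin.elim0 Fin.elim0 (fun i => i.elim0)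

theorem Syn.termOp_mem_iff {ι : Type} [Finite ι] {g : (ι → A) → A} (hg : TermOp S g)
    {P Q : ι → A × A} (hP : ∀ i, P i ∈ μ) (hQ : ∀ i, Q i ∈ μ) (h : ∀ i, Syn S ρ μ (P i) (Q i)) :
    (g fun i => (P i).1, g fun i => (P i).2) ∈ ρ ↔
      (g fun i => (Q i).1, g fun i => (Q i).2) ∈ ρ := by
  classical
  have := Fintype.ofFinite ι
  have key : ∀ s : Finset ι, (g fun i => (P i).1, g fun i => (P i).2) ∈ ρ ↔
      (g fun i => (s.piecewise Q P i).1, g fun i => (s.piecewise Q P i).2) ∈ ρ := by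
    intro s
    induction s using Finset.induction_on with
    | empty => simp
    | insert i s his ih =>
      rw [ih]
      obtain ⟨m, t, κ, ht⟩ := hg.exists_term_cons i
      have := h i m t ((fun j => (s.piecewise Q P j).1) ∘ κ)
        ((fun j => (s.piecewise Q P j).2) ∘ κ) (fun j => by
          by_cases hj : κ j ∈ s
          · simpa [hj] using hQ _
          · simpa [hj] using hP _)
      simp only [ht] at this
      have e : ∀ (f : A × A → A), Function.update (fun j => f (s.piecewise Q P j)) i (f (P i)) =
          fun j => f (s.piecewise Q P j) := fun f => by
        rw [Function.update_eq_iff]; simp [his]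
      have e' : ∀ (f : A × A → A), Function.update (fun j => f (s.piecewise Q P j)) i (f (Q i)) =
          fun j => f ((insert i s).piecewise Q P j) := fun f => by
        rw [Finset.piecewise_insert]
        funext j
        by_cases hj : j = i
        · subst hj; simp
        · simp [hj]
      rwa [e Prod.fst, e Prod.snd, e' Prod.fst, e' Prod.snd] at this
  simpa using key Finset.univ

theorem Syn.termOp {ι : Type} [Finite ι] {g : (ι → A) → A} (hg : TermOp S g)
    {P Q : ι → A × A} (hP : ∀ i, P i ∈ μ) (hQ : ∀ i, Q i ∈ μ) (h : ∀ i, Syn S ρ μ (P i) (Q i)) :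
    Syn S ρ μ (g fun i => (P i).1, g fun i => (P i).2)
      (g fun i => (Q i).1, g fun i => (Q i).2) := by
  intro m t c d hcd
  have hcl : TermOp S fun v : ι ⊕ Fin m → A =>
      t.eval (Fin.cons (g fun i => v (.inl i)) fun j => v (.inr j)) := by
    convert t.termOp.comp (Fin.cons (fun v : ι ⊕ Fin m → A => g fun i => v (.inl i))
      fun j v => v (.inr j)) (Fin.cases (hg.comp _ fun i => .proj _) fun j => .proj _) using 3
      with v
    funext i
    refine Fin.cases rfl (fun j => rfl) i
  exact Syn.termOp_mem_iff hcl (P := Sum.elim P fun j => (c j, d j))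
    (Q := Sum.elim Q fun j => (c j, d j)) (Sum.rec hP hcd) (Sum.rec hQ hcd)
    (Sum.rec h fun _ => .refl _)

theorem Syn.term_cons {p q : A × A} (h : Syn S ρ μ p q) (hp : p ∈ μ) (hq : q ∈ μ) {m : ℕ}
    (t : STerm S (m + 1)) (c d : Fin m → A) (hcd : ∀ i, (c i, d i) ∈ μ) :
    Syn S ρ μ (t.eval (Fin.cons p.1 c), t.eval (Fin.cons p.2 d))
      (t.eval (Fin.cons q.1 c), t.eval (Fin.cons q.2 d)) := by
  have := Syn.termOp t.termOp (P := Fin.cons p fun i => (c i, d i))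
    (Q := Fin.cons q fun i => (c i, d i)) (Fin.cases hp hcd) (Fin.cases hq hcd)
    (Fin.cases h fun _ => .refl _)
  have e : ∀ (f : A × A → A) (x : A × A),
      (fun i : Fin (m + 1) => f ((Fin.cons x fun i => (c i, d i) : Fin (m + 1) → A × A) i)) =
      Fin.cons (f x) fun i => f (c i, d i) := fun f x => by
    funext i
    exact Fin.cases rfl (fun _ => rfl) i
  rwa [e Prod.fst, e Prod.snd, e Prod.fst, e Prod.snd] at this

namespace AbelianInterval

variable (hI : AbelianInterval S ρ μ)
include hI

theorem rho_trans_iff {a b a' b' : A} (ha : (a, a') ∈ ρ) (hb : (b, b') ∈ ρ) :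
    (a, b) ∈ ρ ↔ (a', b') ∈ ρ :=
  ⟨fun h => hI.bot.2.trans (hI.bot.2.symm ha) (hI.bot.2.trans h hb),
    fun h => hI.bot.2.trans ha (hI.bot.2.trans h (hI.bot.2.symm hb))⟩

theorem syn_of_rho {p q : A × A} (h1 : (p.1, q.1) ∈ ρ) (h2 : (p.2, q.2) ∈ ρ) :
    Syn S ρ μ p q := fun _ t _ _ _ => hI.rho_trans_iff
  (t.termOp.congruence hI.bot.1 (Fin.cases h1 fun _ => hI.bot.2.refl _))
  (t.termOp.congruence hI.bot.1 (Fin.cases h2 fun _ => hI.bot.2.refl _))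

theorem term_cons_mem {a b : A} (hab : (a, b) ∈ μ) {m : ℕ} (t : STerm S (m + 1))
    {c d : Fin m → A} (hcd : ∀ i, (c i, d i) ∈ μ) :
    (t.eval (Fin.cons a c), t.eval (Fin.cons b d)) ∈ μ :=
  t.termOp.congruence hI.top.1 (Fin.cases hab hcd)

theorem syn_diag_of_mem {a b : A} (hab : (a, b) ∈ μ) : Syn S ρ μ (a, a) (b, b) :=
  fun m t c d hcd => ⟨hI.abelian m t a b c d hab hcd,
    hI.abelian m t b a c d (hI.top.2.symm hab) hcd⟩

theorem isConOn_syn :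
    IsConOn S μ {x : (A × A) × (A × A) | x.1 ∈ μ ∧ x.2 ∈ μ ∧ Syn S ρ μ x.1 x.2} := by
  refine ⟨fun x hx => ⟨hx.1, hx.2.1⟩, fun o _ hx => ⟨?_, ?_, ?_⟩, fun p hp => ⟨hp, hp, .refl p⟩,
    fun p q h => ⟨h.2.1, h.1, h.2.2.symm⟩, fun p q r h h' => ⟨h.1, h'.2.1, h.2.2.trans h'.2.2⟩⟩
  · exact hI.top.1 o _ fun i => (hx i).1
  · exact hI.top.1 o _ fun i => (hx i).2.1
  · exact Syn.termOp (g := fun v => SAlg.interp o v)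
      (.app o (fun i v => v i) fun i => .proj i) (fun i => (hx i).1) (fun i => (hx i).2.1)
      fun i => (hx i).2.2

theorem isCongruence_syn_diag : IsCongruence S {x : A × A | Syn S ρ μ (x.1, x.1) (x.2, x.2)} :=
  ⟨fun o _ hx => Syn.termOp (g := fun v => SAlg.interp o v)
      (.app o (fun i v => v i) fun i => .proj i) (fun _ => hI.top.2.refl _)
      (fun _ => hI.top.2.refl _) hx,
    fun _ => .refl _, fun h => Syn.symm h, fun h h' => Syn.trans h h'⟩

theorem mem_centralizer_iff {a b : A} :
    (a, b) ∈ centralizer S ρ μ ↔ Syn S ρ μ (a, a) (b, b) := by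
  constructor
  · rintro ⟨φ, ⟨hφ, hc⟩, hab⟩ m t c d hcd
    exact ⟨hc m t a b c d hab hcd, hc m t b a c d (hφ.2.symm hab) hcd⟩
  · intro h
    exact ⟨_, ⟨hI.isCongruence_syn_diag, fun m t a b c d hab hcd => (hab m t c d hcd).1⟩, h⟩

theorem syn_diag_imp {b b' c c' : A} (hb : (b, b') ∈ μ) (hc : (c, c') ∈ μ)
    (h : Syn S ρ μ (b, b') (c, c')) {m : ℕ} (t : STerm S (m + 1)) (q q' : Fin m → A)
    (hq : ∀ i, (q i, q' i) ∈ μ) (ht : (t.eval (Fin.cons b q), t.eval (Fin.cons b q')) ∈ ρ) :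
    (t.eval (Fin.cons c q), t.eval (Fin.cons c q')) ∈ ρ := by
  obtain ⟨d, hd⟩ := hI.diff
  have hqq : ∀ i, (q i, q i) ∈ μ := fun i => hI.top.2.refl _
  have hb' := hI.abelian m t b b' q q' hb hq ht
  refine hI.abelian m t c' c q q' (hI.top.2.symm hc) hq ?_
  have h1 := (h.term_cons hb hc t q q hqq).symm.trans
    ((hI.syn_of_rho (p := (t.eval (Fin.cons b q), t.eval (Fin.cons b' q)))
      (q := (t.eval (Fin.cons b q), t.eval (Fin.cons b' q'))) (hI.bot.2.refl _) hb').trans (h.term_cons hb hc t q q' hq))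
  have m1 := hI.term_cons_mem hc t hqq
  have m2 := hI.term_cons_mem hc t hq
  simp only at h1
  generalize t.eval (Fin.cons c q) = e at h1 m1 m2
  generalize t.eval (Fin.cons c' q) = e₁ at h1 m1 ⊢
  generalize t.eval (Fin.cons c' q') = e₂ at h1 m2 ⊢
  have key := Syn.termOp_mem_iff (ρ := ρ) (μ := μ) d.termOp
    (P := ![(e, e₁), (e, e₂), (e₂, e₂)])
    (Q := ![(e, e₂), (e, e₂), (e₂, e₂)])
    (by simp [Fin.forall_fin_succ, m1, m2, hI.top.2.refl e₂])
    (by simp [Fin.forall_fin_succ, m2, hI.top.2.refl e₂])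
    (by simp [Fin.forall_fin_succ, h1, Syn.refl])
  have e3 : ∀ (f : A × A → A) (x y z : A × A),
      (fun i => f ((![x, y, z] : Fin 3 → A × A) i)) = ![f x, f y, f z] := fun f x y z => by
    funext i; fin_cases i <;> rfl
  rw [e3 Prod.fst, e3 Prod.snd, e3 Prod.fst, e3 Prod.snd] at key
  have he : (e₂, e) ∈ μ := hI.top.2.symm m2
  have he' : (e₁, e₂) ∈ μ := hI.top.2.trans (hI.top.2.symm m1) m2
  have h2 := key.2 ((hI.rho_trans_iff (hd e₂ e he).2 (hd e₂ e₂ (hI.top.2.refl _)).1).2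
    (hI.bot.2.refl _))
  exact hI.bot.2.symm ((hI.rho_trans_iff (hd e₂ e he).2 (hd e₁ e₂ he').1).1 h2)

theorem syn_diag {b b' c c' : A} (hb : (b, b') ∈ μ) (hc : (c, c') ∈ μ)
    (h : Syn S ρ μ (b, b') (c, c')) : Syn S ρ μ (b, b) (c, c) := fun _ t q q' hq =>
  ⟨hI.syn_diag_imp hb hc h t q q' hq, hI.syn_diag_imp hc hb h.symm t q q' hq⟩

/-- By the difference term, a stable subuniverse between `ρ` and `μ` is a congruence. -/
theorem isCongruence_of_stable {L : Set (A × A)} (hL : IsSubuniverse S L) (hρL : ρ ⊆ L)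
    (hLμ : L ⊆ μ)
    (hst : ∀ a b a' b', (a, b) ∈ L → (a, a') ∈ ρ → (b, b') ∈ ρ → (a', b') ∈ L) :
    IsCongruence S L := by
  obtain ⟨d, hd⟩ := hI.diff
  have hdL : ∀ x y z x' y' z', (x, x') ∈ L → (y, y') ∈ L → (z, z') ∈ L →
      (d.eval ![x, y, z], d.eval ![x', y', z']) ∈ L := fun x y z x' y' z' h1 h2 h3 =>
    d.termOp.congruence hL (by simp [Fin.forall_fin_succ, h1, h2, h3])
  have hr : ∀ x, (x, x) ∈ L := fun x => hρL (hI.bot.2.refl x)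
  refine ⟨hL, hr, fun {x y} h => ?_, fun {x y z} h h' => ?_⟩
  · exact hst _ _ _ _ (hdL _ _ _ _ _ _ (hr x) h (hr y)) (hd y x (hI.top.2.symm (hLμ h))).2
      (hd x y (hLμ h)).1
  · exact hst _ _ _ _ (hdL _ _ _ _ _ _ h (hr y) h') (hd x y (hLμ h)).1
      (hd z y (hI.top.2.symm (hLμ h'))).2

end AbelianInterval

end Syntactic

section Bridges

variable {S : Signature} {A B : Type} [SAlg S A] [SAlg S B] {ρ μ : Set (A × A)}
  {σ ν : Set (B × B)} {T : Set (A × A × B × B)}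

theorem STerm.eval_mem_of_isSubuniverse {m : ℕ} (t : STerm S m) (hT : IsSubuniverse S T)
    {a a' : Fin m → A} {b b' : Fin m → B} (h : ∀ i, (a i, a' i, b i, b' i) ∈ T) :
    (t.eval a, t.eval a', t.eval b, t.eval b') ∈ T := by
  induction t with
  | var i => exact h i
  | app o ts ih =>
    exact hT o (fun i => ((ts i).eval a, (ts i).eval a', (ts i).eval b, (ts i).eval b')) ih

theorem STerm.eval_cons_mem_of_isSubuniverse {m : ℕ} (t : STerm S (m + 1))
    (hT : IsSubuniverse S T) {x x' : A} {y y' : B} (hx : (x, x', y, y') ∈ T)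
    {a a' : Fin m → A} {b b' : Fin m → B} (h : ∀ i, (a i, a' i, b i, b' i) ∈ T) :
    (t.eval (Fin.cons x a), t.eval (Fin.cons x' a'), t.eval (Fin.cons y b),
      t.eval (Fin.cons y' b')) ∈ T :=
  t.eval_mem_of_isSubuniverse hT (Fin.cases hx h)

namespace IsBridgeLR

theorem conv (hT : IsBridgeLR S ρ σ μ ν T) : IsBridgeLR S σ ρ ν μ (bConv T) := by
  obtain ⟨⟨h1, h2, h3, h4, h5, h6⟩, rfl, rfl⟩ := hT
  exact ⟨⟨fun o x hx => h1 o (fun i => ((x i).2.2.1, (x i).2.2.2, (x i).1, (x i).2.1)) hx,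
    fun a₁ a₂ b₁ b₂ a₁' a₂' h => h3 b₁ b₂ a₁ a₂ a₁' a₂' h,
    fun a₁ a₂ b₁ b₂ b₁' b₂' h => h2 b₁ b₂ a₁ a₂ b₁' b₂' h, h5, h4,
    fun a₁ a₂ b₁ b₂ h => (h6 b₁ b₂ a₁ a₂ h).symm⟩, rfl, rfl⟩

theorem exists_right (hT : IsBridgeLR S ρ σ μ ν T) {a a' : A} (h : (a, a') ∈ μ) :
    ∃ b b', (a, a', b, b') ∈ T := by
  obtain ⟨_, rfl, _⟩ := hT; exact h

theorem exists_left (hT : IsBridgeLR S ρ σ μ ν T) {b b' : B} (h : (b, b') ∈ ν) :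
    ∃ a a', (a, a', b, b') ∈ T := by
  obtain ⟨_, _, rfl⟩ := hT; exact h

theorem left_mem (hT : IsBridgeLR S ρ σ μ ν T) {a a' : A} {b b' : B} (h : (a, a', b, b') ∈ T) :
    (a, a') ∈ μ := by
  obtain ⟨_, rfl, _⟩ := hT; exact ⟨b, b', h⟩

theorem right_mem (hT : IsBridgeLR S ρ σ μ ν T) {a a' : A} {b b' : B}
    (h : (a, a', b, b') ∈ T) : (b, b') ∈ ν := by
  obtain ⟨_, _, rfl⟩ := hT; exact ⟨a, a', h⟩

theorem mem_iff (hT : IsBridgeLR S ρ σ μ ν T) {a a' : A} {b b' : B} (h : (a, a', b, b') ∈ T) :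
    (a, a') ∈ ρ ↔ (b, b') ∈ σ :=
  hT.1.2.2.2.2.2 a a' b b' h

/-- A bridge maps syntactically equivalent pairs to syntactically equivalent pairs. -/
theorem syn_right (hT : IsBridgeLR S ρ σ μ ν T) {a₁ a₂ a₁' a₂' : A} {b₁ b₂ b₁' b₂' : B}
    (h : (a₁, a₂, b₁, b₂) ∈ T) (h' : (a₁', a₂', b₁', b₂') ∈ T)
    (hs : Syn S ρ μ (a₁, a₂) (a₁', a₂')) : Syn S σ ν (b₁, b₂) (b₁', b₂') := by
  intro m t c d hcd
  choose e f hef using fun i => hT.exists_left (hcd i)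
  have h1 := hT.mem_iff (t.eval_cons_mem_of_isSubuniverse hT.1.1 h hef)
  have h2 := hT.mem_iff (t.eval_cons_mem_of_isSubuniverse hT.1.1 h' hef)
  rw [← h1, ← h2]
  exact hs m t e f fun i => hT.left_mem (hef i)

theorem syn_left (hT : IsBridgeLR S ρ σ μ ν T) {a₁ a₂ a₁' a₂' : A} {b₁ b₂ b₁' b₂' : B}
    (h : (a₁, a₂, b₁, b₂) ∈ T) (h' : (a₁', a₂', b₁', b₂') ∈ T)
    (hs : Syn S σ ν (b₁, b₂) (b₁', b₂')) : Syn S ρ μ (a₁, a₂) (a₁', a₂') :=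
  hT.conv.syn_right (T := bConv T) h h' hs

theorem exists_btr_right (hT : IsBridgeLR S ρ σ μ ν T) (hA : AbelianInterval S ρ μ)
    (hB : AbelianInterval S σ ν) (a : A) : ∃ b, (a, b) ∈ btr T := by
  obtain ⟨b, b', h⟩ := hT.exists_right (hA.top.2.refl a)
  have hb := (hT.mem_iff h).1 (hA.bot.2.refl a)
  exact ⟨b, hT.1.2.2.1 _ _ _ _ _ _ h (hB.bot.2.refl b) (hB.bot.2.symm hb)⟩

theorem exists_btr_left (hT : IsBridgeLR S ρ σ μ ν T) (hA : AbelianInterval S ρ μ)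
    (hB : AbelianInterval S σ ν) (b : B) : ∃ a, (a, b) ∈ btr T :=
  hT.conv.exists_btr_right hB hA b

/-- The trace of a bridge, saturated by the syntactic congruences. -/
def Linked (S : Signature) {A B : Type} [SAlg S A] [SAlg S B] (ρ μ : Set (A × A))
    (σ ν : Set (B × B)) (T : Set (A × A × B × B)) (a : A) (b : B) : Prop :=
  ∃ a' b', Syn S ρ μ (a, a) (a', a') ∧ Syn S σ ν (b, b) (b', b') ∧ (a', b') ∈ btr T

/-- If all linked tuples of a bridge are trivial, then so is the whole bridge. -/
theorem left_mem_of_forall_linked (hT : IsBridgeLR S ρ σ μ ν T) (hA : AbelianInterval S ρ μ)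
    (hB : AbelianInterval S σ ν)
    (H : ∀ a₁ a₂ b₁ b₂, (a₁, a₂, b₁, b₂) ∈ T → Linked S ρ μ σ ν T a₁ b₁ → (a₁, a₂) ∈ ρ)
    {a a₁ : A} {c c₁ : B} (h : (a, a₁, c, c₁) ∈ T) : (a, a₁) ∈ ρ := by
  obtain ⟨x, hx⟩ := hT.exists_btr_left hA hB c
  obtain ⟨y, hy⟩ := hT.exists_btr_right hA hB a
  have hsub := hT.1.1
  refine H a a₁ c c₁ h ⟨x, c, fun m t q q' hq => ?_, .refl _, hx⟩
  choose d d' hd using fun i => hT.exists_right (hq i)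
  choose β hβ using fun i => hT.exists_btr_right hA hB (q i)
  choose δ hδ using fun i => hT.exists_btr_left hA hB (d i)
  have hax := hT.left_mem h
  have hcx := hT.right_mem h
  have t₁ := t.eval_cons_mem_of_isSubuniverse hsub h hd
  constructor
  · intro hρ
    have hρ₁ := hA.abelian m t a a₁ q q' hax hq hρ
    have t₂ := t.eval_cons_mem_of_isSubuniverse hsub h hβ
    have hs := hB.syn_diag (hT.right_mem t₁) (hT.right_mem t₂)
      (hT.syn_right t₁ t₂ (hA.syn_of_rho (hA.bot.2.refl _) (hA.bot.2.symm hρ₁)))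
    exact H _ _ _ _ (t.eval_cons_mem_of_isSubuniverse hsub hx hd)
      ⟨_, _, .refl _, hs, t.eval_cons_mem_of_isSubuniverse hsub hx hβ⟩
  · intro hρ
    have hσ := (hT.mem_iff (t.eval_cons_mem_of_isSubuniverse hsub hx hd)).1 hρ
    have hσ₁ := hB.abelian m t c c₁ d d' hcx (fun i => hT.right_mem (hd i)) hσ
    have t₂ := t.eval_cons_mem_of_isSubuniverse hsub h hδ
    have hs := hA.syn_diag (hT.left_mem t₁) (hT.left_mem t₂)
      (hT.syn_left t₁ t₂ (hB.syn_of_rho (hB.bot.2.refl _) (hB.bot.2.symm hσ₁)))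
    exact H _ _ _ _ (t.eval_cons_mem_of_isSubuniverse hsub hy hd)
      ⟨_, _, hs, .refl _, t.eval_cons_mem_of_isSubuniverse hsub hy hδ⟩

theorem exists_linked (hT : IsBridgeLR S ρ σ μ ν T) (hA : AbelianInterval S ρ μ)
    (hB : AbelianInterval S σ ν) :
    ∃ a₁ a₂ b₁ b₂, (a₁, a₂, b₁, b₂) ∈ T ∧ (a₁, a₂) ∉ ρ ∧ Linked S ρ μ σ ν T a₁ b₁ := by
  by_contra hno
  refine hT.1.2.2.2.1.2 ?_
  rintro ⟨a, a₁⟩ ⟨c, c₁, h⟩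
  refine hT.left_mem_of_forall_linked hA hB (fun a₁ a₂ b₁ b₂ h hl => ?_) h
  by_contra hρ
  exact hno ⟨a₁, a₂, b₁, b₂, h, hρ, hl⟩

end IsBridgeLR

end Bridges

section OptimalBridge

variable {S : Signature} {A B : Type} [SAlg S A] [SAlg S B] {ρ μ : Set (A × A)}
  {σ ν : Set (B × B)} {T : Set (A × A × B × B)}

theorem isSubuniverse_bComp {C : Type} [SAlg S C] {T : Set (A × A × B × B)}
    {T' : Set (B × B × C × C)} (hT : IsSubuniverse S T) (hT' : IsSubuniverse S T') :
    IsSubuniverse S (bComp T T') := by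
  intro o x hx
  choose b b' h h' using hx
  exact ⟨_, _, hT o (fun i => ((x i).1, (x i).2.1, b i, b' i)) h,
    hT' o (fun i => (b i, b' i, (x i).2.2.1, (x i).2.2.2)) h'⟩

theorem isSubuniverse_idBridge (hρ : IsSubuniverse S ρ) (hμ : IsSubuniverse S μ) :
    IsSubuniverse S (idBridge ρ μ) := fun o x hx =>
  ⟨hμ o (fun i => ((x i).1, (x i).2.1)) fun i => (hx i).1,
    hμ o (fun i => ((x i).2.2.1, (x i).2.2.2)) fun i => (hx i).2.1,
    hρ o (fun i => ((x i).1, (x i).2.2.1)) fun i => (hx i).2.2.1,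
    hρ o (fun i => ((x i).2.1, (x i).2.2.2)) fun i => (hx i).2.2.2⟩

theorem isSubuniverse_deltaFlat (θ α : Set (A × A)) : IsSubuniverse S (deltaFlat S θ α) :=
  fun o x hx Δ hΔ => hΔ.1.2.1 o
    (fun i => (((x i).1, (x i).2.1), ((x i).2.2.1, (x i).2.2.2))) fun i => hx i Δ hΔ

theorem isSubuniverse_btr (hT : IsSubuniverse S T) : IsSubuniverse S (btr T) :=
  fun o x hx => hT o (fun i => ((x i).1, (x i).1, (x i).2, (x i).2)) hx

namespace AbelianInterval

variable (hI : AbelianInterval S ρ μ)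
include hI

theorem isSubuniverse_topt : IsSubuniverse S (Topt S ρ μ) :=
  have h := isSubuniverse_idBridge hI.bot.1 hI.top.1
  isSubuniverse_bComp h (isSubuniverse_bComp (isSubuniverse_deltaFlat _ _) h)

theorem syn_of_deltaCon {p q : A × A} (h : (p, q) ∈ DeltaCon S μ (centralizer S ρ μ)) :
    p ∈ μ ∧ q ∈ μ ∧ Syn S ρ μ p q :=
  h _ ⟨hI.isConOn_syn, fun a b hab =>
    ⟨hI.top.2.refl a, hI.top.2.refl b, hI.mem_centralizer_iff.1 hab⟩⟩

theorem syn_of_topt {a₁ a₂ b₁ b₂ : A} (h : (a₁, a₂, b₁, b₂) ∈ Topt S ρ μ) :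
    (a₁, a₂) ∈ μ ∧ (b₁, b₂) ∈ μ ∧ Syn S ρ μ (a₁, a₂) (b₁, b₂) := by
  obtain ⟨x₁, x₂, ⟨h1, -, h2, h3⟩, y₁, y₂, h4, ⟨-, h5, h6, h7⟩⟩ := h
  exact ⟨h1, h5, (hI.syn_of_rho h2 h3).trans
    ((hI.syn_of_deltaCon h4).2.2.trans (hI.syn_of_rho h6 h7))⟩

theorem idBridge_self {a₁ a₂ : A} (h : (a₁, a₂) ∈ μ) : (a₁, a₂, a₁, a₂) ∈ idBridge ρ μ :=
  ⟨h, h, hI.bot.2.refl _, hI.bot.2.refl _⟩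

theorem topt_self {a₁ a₂ : A} (h : (a₁, a₂) ∈ μ) : (a₁, a₂, a₁, a₂) ∈ Topt S ρ μ :=
  ⟨a₁, a₂, hI.idBridge_self h, a₁, a₂, fun _ hΔ => hΔ.1.2.2.1 _ h, hI.idBridge_self h⟩

theorem topt_diag {a b : A} (h : Syn S ρ μ (a, a) (b, b)) : (a, a, b, b) ∈ Topt S ρ μ :=
  ⟨a, a, hI.idBridge_self (hI.top.2.refl a), b, b,
    fun _ hΔ => hΔ.2 a b (hI.mem_centralizer_iff.2 h), hI.idBridge_self (hI.top.2.refl b)⟩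

theorem mem_of_rho {a₁ a₂ a₁' a₂' : A} (h : (a₁, a₂) ∈ μ) (h1 : (a₁, a₁') ∈ ρ)
    (h2 : (a₂, a₂') ∈ ρ) : (a₁', a₂') ∈ μ :=
  hI.top.2.trans (hI.top.2.symm (hI.le h1)) (hI.top.2.trans h (hI.le h2))

theorem topt_left {a₁ a₂ a₁' a₂' b₁ b₂ : A} (h : (a₁, a₂, b₁, b₂) ∈ Topt S ρ μ)
    (h1 : (a₁, a₁') ∈ ρ) (h2 : (a₂, a₂') ∈ ρ) : (a₁', a₂', b₁, b₂) ∈ Topt S ρ μ := by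
  obtain ⟨x₁, x₂, ⟨h3, h4, h5, h6⟩, hr⟩ := h
  exact ⟨x₁, x₂, ⟨hI.mem_of_rho h3 h1 h2, h4, hI.bot.2.trans (hI.bot.2.symm h1) h5,
    hI.bot.2.trans (hI.bot.2.symm h2) h6⟩, hr⟩

theorem topt_right {a₁ a₂ b₁ b₂ b₁' b₂' : A} (h : (a₁, a₂, b₁, b₂) ∈ Topt S ρ μ)
    (h1 : (b₁, b₁') ∈ ρ) (h2 : (b₂, b₂') ∈ ρ) : (a₁, a₂, b₁', b₂') ∈ Topt S ρ μ := by
  obtain ⟨x₁, x₂, hl, y₁, y₂, hm, ⟨h3, h4, h5, h6⟩⟩ := h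
  exact ⟨x₁, x₂, hl, y₁, y₂, hm, ⟨h3, hI.mem_of_rho h4 h1 h2, hI.bot.2.trans h5 h1,
    hI.bot.2.trans h6 h2⟩⟩

end AbelianInterval

/-- The bridge `T^opt ∘ T ∘ T^opt`. -/
abbrev optComp (S : Signature) {A B : Type} [SAlg S A] [SAlg S B] (ρ μ : Set (A × A))
    (σ ν : Set (B × B)) (T : Set (A × A × B × B)) : Set (A × A × B × B) :=
  bComp (Topt S ρ μ) (bComp T (Topt S σ ν))

/-- The part of a quaternary relation satisfying (B3). -/
def traceRestrict (T : Set (A × A × B × B)) : Set (A × A × B × B) :=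
  {x | x ∈ T ∧ (x.1, x.2.2.1) ∈ btr T ∧ (x.2.1, x.2.2.2) ∈ btr T}

theorem btr_traceRestrict (T : Set (A × A × B × B)) : btr (traceRestrict T) = btr T :=
  Set.ext fun _ => ⟨fun h => h.1, fun h => ⟨h, h, h⟩⟩

theorem isSubuniverse_traceRestrict (hT : IsSubuniverse S T) :
    IsSubuniverse S (traceRestrict T) := fun o x hx =>
  ⟨hT o x fun i => (hx i).1,
    isSubuniverse_btr hT o (fun i => ((x i).1, (x i).2.2.1)) fun i => (hx i).2.1,
    isSubuniverse_btr hT o (fun i => ((x i).2.1, (x i).2.2.2)) fun i => (hx i).2.2⟩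

/-- A stable subuniverse strictly between `ρ` and its cover `μ` equals `μ`. -/
theorem AbelianInterval.eq_of_stable (hA : AbelianInterval S ρ μ) (hρ : MeetIrredWith S ρ μ)
    {L : Set (A × A)} (hL : IsSubuniverse S L) (hρL : ρ ⊂ L) (hLμ : L ⊆ μ)
    (hst : ∀ a b a' b', (a, b) ∈ L → (a, a') ∈ ρ → (b, b') ∈ ρ → (a', b') ∈ L) : L = μ :=
  hLμ.antisymm (hρ.2.2.2.2 L (hA.isCongruence_of_stable hL hρL.1 hLμ hst) hρL)

section

variable (hA : AbelianInterval S ρ μ) (hB : AbelianInterval S σ ν)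
  (hT : IsBridgeLR S ρ σ μ ν T)

include hA in
theorem optComp_left {a₁ a₂ a₁' a₂' : A} {b₁ b₂ : B}
    (h : (a₁, a₂, b₁, b₂) ∈ optComp S ρ μ σ ν T) (h1 : (a₁, a₁') ∈ ρ) (h2 : (a₂, a₂') ∈ ρ) :
    (a₁', a₂', b₁, b₂) ∈ optComp S ρ μ σ ν T := by
  obtain ⟨x₁, x₂, hl, hr⟩ := h
  exact ⟨x₁, x₂, hA.topt_left hl h1 h2, hr⟩

include hB in
theorem optComp_right {a₁ a₂ : A} {b₁ b₂ b₁' b₂' : B}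
    (h : (a₁, a₂, b₁, b₂) ∈ optComp S ρ μ σ ν T) (h1 : (b₁, b₁') ∈ σ) (h2 : (b₂, b₂') ∈ σ) :
    (a₁, a₂, b₁', b₂') ∈ optComp S ρ μ σ ν T := by
  obtain ⟨x₁, x₂, hl, y₁, y₂, hm, hr⟩ := h
  exact ⟨x₁, x₂, hl, y₁, y₂, hm, hB.topt_right hr h1 h2⟩

include hA in
theorem traceRestrict_left {a₁ a₂ a₁' a₂' : A} {b₁ b₂ : B}
    (h : (a₁, a₂, b₁, b₂) ∈ traceRestrict (optComp S ρ μ σ ν T)) (h1 : (a₁, a₁') ∈ ρ)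
    (h2 : (a₂, a₂') ∈ ρ) : (a₁', a₂', b₁, b₂) ∈ traceRestrict (optComp S ρ μ σ ν T) :=
  ⟨optComp_left hA h.1 h1 h2, optComp_left hA h.2.1 h1 h1,
    optComp_left hA h.2.2 h2 h2⟩

include hB in
theorem traceRestrict_right {a₁ a₂ : A} {b₁ b₂ b₁' b₂' : B}
    (h : (a₁, a₂, b₁, b₂) ∈ traceRestrict (optComp S ρ μ σ ν T)) (h1 : (b₁, b₁') ∈ σ)
    (h2 : (b₂, b₂') ∈ σ) : (a₁, a₂, b₁', b₂') ∈ traceRestrict (optComp S ρ μ σ ν T) :=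
  ⟨optComp_right hB h.1 h1 h2, optComp_right hB h.2.1 h1 h1,
    optComp_right hB h.2.2 h2 h2⟩

include hA hB

include hT in
theorem optComp_mem_iff {a₁ a₂ : A} {b₁ b₂ : B}
    (h : (a₁, a₂, b₁, b₂) ∈ optComp S ρ μ σ ν T) : (a₁, a₂) ∈ ρ ↔ (b₁, b₂) ∈ σ := by
  obtain ⟨x₁, x₂, hl, y₁, y₂, hm, hr⟩ := h
  exact (hA.syn_of_topt hl).2.2.mem_iff.trans
    ((hT.mem_iff hm).trans (hB.syn_of_topt hr).2.2.mem_iff)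

include hT in
theorem mem_optComp {a₁ a₂ : A} {b₁ b₂ : B} (h : (a₁, a₂, b₁, b₂) ∈ T) :
    (a₁, a₂, b₁, b₂) ∈ optComp S ρ μ σ ν T :=
  ⟨a₁, a₂, hA.topt_self (hT.left_mem h), b₁, b₂, h, hB.topt_self (hT.right_mem h)⟩

theorem mem_btr_optComp {a : A} {b : B} (h : IsBridgeLR.Linked S ρ μ σ ν T a b) :
    (a, b) ∈ btr (optComp S ρ μ σ ν T) := by
  obtain ⟨a', b', ha, hb, h⟩ := h
  exact ⟨a', a', hA.topt_diag ha, b', b', h, hB.topt_diag hb.symm⟩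

include hT in
/-- The (B3) part of `T^opt ∘ T ∘ T^opt` is a bridge with full anchors. -/
theorem isBridgeLR_traceRestrict (hρ : MeetIrredWith S ρ μ) (hσ : MeetIrredWith S σ ν) :
    IsBridgeLR S ρ σ μ ν (traceRestrict (optComp S ρ μ σ ν T)) := by
  obtain ⟨a₁, a₂, b₁, b₂, hmem, hnρ, hl⟩ := hT.exists_linked hA hB
  have hl' : IsBridgeLR.Linked S ρ μ σ ν T a₂ b₂ := by
    obtain ⟨a', b', ha, hb, h⟩ := hl
    exact ⟨a', b', (hA.syn_diag_of_mem (hT.left_mem hmem)).symm.trans ha,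
      (hB.syn_diag_of_mem (hT.right_mem hmem)).symm.trans hb, h⟩
  have hmem' : (a₁, a₂, b₁, b₂) ∈ traceRestrict (optComp S ρ μ σ ν T) :=
    ⟨mem_optComp hA hB hT hmem, mem_btr_optComp hA hB hl, mem_btr_optComp hA hB hl'⟩
  have hnσ : (b₁, b₂) ∉ σ := fun h => hnρ ((hT.mem_iff hmem).2 h)
  have hdiag : ∀ {a b}, (a, b) ∈ btr T →
      (a, a, b, b) ∈ traceRestrict (optComp S ρ μ σ ν T) := fun h =>
    have h' := mem_optComp hA hB hT h
    ⟨h', h', h'⟩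
  have hsub : IsSubuniverse S (traceRestrict (optComp S ρ μ σ ν T)) :=
    isSubuniverse_traceRestrict (isSubuniverse_bComp hA.isSubuniverse_topt
      (isSubuniverse_bComp hT.1.1 hB.isSubuniverse_topt))
  have hρL : ρ ⊂ pr12 (traceRestrict (optComp S ρ μ σ ν T)) := by
    refine ⟨?_, fun h => hnρ (h ⟨b₁, b₂, hmem'⟩)⟩
    rintro ⟨a, a'⟩ h
    obtain ⟨b, hb⟩ := hT.exists_btr_right hA hB a
    exact ⟨b, b, traceRestrict_left hA (hdiag hb) (hA.bot.2.refl a) h⟩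
  have hσR : σ ⊂ pr34 (traceRestrict (optComp S ρ μ σ ν T)) := by
    refine ⟨?_, fun h => hnσ (h ⟨a₁, a₂, hmem'⟩)⟩
    rintro ⟨b, b'⟩ h
    obtain ⟨a, ha⟩ := hT.exists_btr_left hA hB b
    exact ⟨a, a, traceRestrict_right hB (hdiag ha) (hB.bot.2.refl b) h⟩
  refine ⟨⟨hsub, fun _ _ _ _ _ _ => traceRestrict_left hA,
    fun _ _ _ _ _ _ => traceRestrict_right hB, hρL, hσR,
    fun _ _ _ _ h => optComp_mem_iff hA hB hT h.1⟩, ?_, ?_⟩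
  · refine hA.eq_of_stable hρ (fun o x hx => ?_) hρL ?_ ?_
    · choose b b' h using hx
      exact ⟨_, _, hsub o (fun i => ((x i).1, (x i).2, b i, b' i)) h⟩
    · rintro ⟨a, a'⟩ ⟨b, b', ⟨x₁, x₂, h, -⟩, -⟩
      exact (hA.syn_of_topt h).1
    · rintro a b a' b' ⟨c, d, h⟩ h1 h2
      exact ⟨c, d, traceRestrict_left hA h h1 h2⟩
  · refine hB.eq_of_stable hσ (fun o x hx => ?_) hσR ?_ ?_
    · choose a a' h using hx
      exact ⟨_, _, hsub o (fun i => (a i, a' i, (x i).1, (x i).2)) h⟩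
    · rintro ⟨b, b'⟩ ⟨a, a', ⟨x₁, x₂, -, y₁, y₂, -, h⟩, -⟩
      exact (hB.syn_of_topt h).2.1
    · rintro a b a' b' ⟨c, d, h⟩ h1 h2
      exact ⟨c, d, traceRestrict_right hB h h1 h2⟩

end

theorem MeetIrredWith.abelianInterval [Finite A] (hρ : MeetIrredWith S ρ μ)
    (hab : Centralizes S μ μ ρ) {n : ℕ} {t : STerm S n} {u v : Fin n → Fin n → Fin 2}
    (huv : ∀ i, u i i ≠ v i i) (ht : TaylorOn S A t u v) : AbelianInterval S ρ μ :=
  ⟨hρ.1, hρ.2.2.1, hρ.2.2.2.1.1, hab,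
    exists_difference_term t u v huv ht hρ.2.2.1 hρ.1 hρ.2.2.2.1.1 hab⟩

end OptimalBridge

end Zhuk

/-- in the abelian case, for every bridge `T` from `(A,ρ,ρ⁺)` to
`(B,σ,σ⁺)`, the bridge `T' = T^opt_{(A,ρ)} ∘ T ∘ T^opt_{(B,σ)}` contains a bridge `T₁`
from `(A,ρ,ρ⁺)` to `(B,σ,σ⁺)` with `tr(T₁) = tr(T')` satisfying (B3). -/
theorem stmt_17 {S : Zhuk.Signature} {A B : Type} [Zhuk.SAlg S A] [Zhuk.SAlg S B]
    [Finite A] [Finite B]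
    (hTay : Zhuk.CommonTaylor S A B)
    (ρ ρplus : Set (A × A)) (σ σplus : Set (B × B))
    (hρ : Zhuk.MeetIrredWith S ρ ρplus) (hσ : Zhuk.MeetIrredWith S σ σplus)
    (habρ : Zhuk.Centralizes S ρplus ρplus ρ) (habσ : Zhuk.Centralizes S σplus σplus σ)
    (T : Set (A × A × B × B)) (hT : Zhuk.IsBridgeLR S ρ σ ρplus σplus T) :
    ∃ T₁ ⊆ Zhuk.bComp (Zhuk.Topt S ρ ρplus) (Zhuk.bComp T (Zhuk.Topt S σ σplus)),
      Zhuk.IsBridgeLR S ρ σ ρplus σplus T₁ ∧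
      Zhuk.btr T₁ =
        Zhuk.btr (Zhuk.bComp (Zhuk.Topt S ρ ρplus) (Zhuk.bComp T (Zhuk.Topt S σ σplus))) ∧
      (∀ a₁ a₂ b₁ b₂, (a₁, a₂, b₁, b₂) ∈ T₁ →
        (a₁, b₁) ∈ Zhuk.btr T₁ ∧ (a₂, b₂) ∈ Zhuk.btr T₁) := by
  obtain ⟨n, t, u, v, -, huv, htA, htB⟩ := hTay
  have hA := hρ.abelianInterval habρ huv htA
  have hB := hσ.abelianInterval habσ huv htB
  have htr := Zhuk.btr_traceRestrict (Zhuk.optComp S ρ ρplus σ σplus T)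
  exact ⟨Zhuk.traceRestrict (Zhuk.optComp S ρ ρplus σ σplus T), fun _ h => h.1,
    Zhuk.isBridgeLR_traceRestrict hA hB hT hρ hσ, htr, fun _ _ _ _ h => htr ▸ h.2⟩
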